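/- Let ϑ be a fixed set-valued substitution such that (ϑ, P) is primitive for every choice of non-degenerate probability data P, and regard P as a vector in R^r (r = Σ_{i=1}^d #ϑ(a_i)) ranging over the set of families of strictly positive probability vectors, equipped with the Euclidean topology. Then the map P ↦ h(μ_P), sending the probability data to the measure-theoretic entropy of the corresponding frequency measure, is continuous. -/

import Mathlib

open Filter MeasureTheory

namespace RandomSubstitutionTheory

variable {A : Type*} [Fintype A] [DecidableEq A]

/-- The set of realisations of `ϑ(u)` for a word `u`. -/
def reals (θ : A → Finset (List A)) : List A → Finset (List A)
  | [] => {[]}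
  | a :: u => (θ a).biUnion fun v => (reals θ u).image fun w => v ++ w

/-- The set of realisations of `ϑ^n(u)` for a word `u`. -/
def realsIter (θ : A → Finset (List A)) : ℕ → List A → Finset (List A)
  | 0, u => {u}
  | n + 1, u => (reals θ u).biUnion fun v => realsIter θ n v

/-- `wordProb θ P u w` is the probability `P[ϑ_P(u) = w]`, each letter of `u` being
substituted independently. -/
noncomputable def wordProb (θ : A → Finset (List A)) (P : A → List A → ℝ) :
    List A → List A → ℝ
  | [], w => if w = [] then 1 else 0
  | a :: u, w =>
      ∑ v ∈ θ a, P a v * (if v <+: w then wordProb θ P u (w.drop v.length) else 0)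

/-- `iterProb θ P n u w` is the probability `P[ϑ_P^n(u) = w]` of the induced Markov chain. -/
noncomputable def iterProb (θ : A → Finset (List A)) (P : A → List A → ℝ) :
    ℕ → List A → List A → ℝ
  | 0, u, w => if u = w then 1 else 0
  | n + 1, u, w => ∑ v ∈ reals θ u, wordProb θ P u v * iterProb θ P n v w

/-- The substitution matrix `M_{ij} = E[|ϑ_P(a_j)|_{a_i}]`. -/
noncomputable def substM (θ : A → Finset (List A)) (P : A → List A → ℝ) :
    Matrix A A ℝ :=
  Matrix.of fun i j => ∑ w ∈ θ j, P j w * (w.count i : ℝ)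

/-- The defining data of a random substitution: nonempty finite sets of nonempty words
and strictly positive probability vectors. -/
def IsRandomSubstitution (θ : A → Finset (List A)) (P : A → List A → ℝ) : Prop :=
  (∀ a, (θ a).Nonempty) ∧ (∀ a, ∀ w ∈ θ a, w ≠ []) ∧
    (∀ a, ∀ w ∈ θ a, 0 < P a w) ∧ (∀ a w, w ∉ θ a → P a w = 0) ∧
    ∀ a, ∑ w ∈ θ a, P a w = 1

/-- Primitivity of the substitution matrix: some power has strictly positive entries. -/
def IsPrimitive (θ : A → Finset (List A)) (P : A → List A → ℝ) : Prop :=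
  ∃ k : ℕ, ∀ i j : A, 0 < (substM θ P ^ k) i j

/-- The Perron–Frobenius eigenvalue is `> 1` (witnessed by a positive right eigenvector). -/
def IsExpanding (θ : A → Finset (List A)) (P : A → List A → ℝ) : Prop :=
  ∃ lam : ℝ, 1 < lam ∧ ∃ R : A → ℝ, (∀ a, 0 < R a) ∧ (substM θ P).mulVec R = lam • R

/-- A word is legal if it occurs as a subword of some level-`k` inflation word. -/
def Legal (θ : A → Finset (List A)) (u : List A) : Prop :=
  ∃ (a : A) (k : ℕ) (w : List A), w ∈ realsIter θ k [a] ∧ u <:+: w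

/-- All words of length `n` over the alphabet. -/
def allWords (A : Type*) [Fintype A] [DecidableEq A] (n : ℕ) : Finset (List A) :=
  (Finset.univ : Finset (Fin n → A)).image List.ofFn

/-- All legal words of length `n`. -/
noncomputable def legalWords (θ : A → Finset (List A)) (n : ℕ) : Finset (List A) :=
  letI := Classical.decPred (Legal θ)
  (allWords A n).filter (Legal θ)

/-- The left shift on bi-infinite sequences. -/
def shift : (ℤ → A) → ℤ → A := fun x i => x (i + 1)

/-- The finite word of length `n` read off a bi-infinite sequence starting at position `m`. -/
def window (x : ℤ → A) (m : ℤ) (n : ℕ) : List A :=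
  (List.range n).map fun t => x (m + (t : ℤ))

/-- The random substitution subshift `X_ϑ`. -/
def Xtheta (θ : A → Finset (List A)) : Set (ℤ → A) :=
  {x | ∀ (m : ℤ) (n : ℕ), Legal θ (window x m n)}

/-- The cylinder set of the word `v` at position `m`. -/
def cylinder (v : List A) (m : ℤ) : Set (ℤ → A) :=
  {x | window x m v.length = v}

/-- The number `|w|_v` of (possibly overlapping) occurrences of `v` in `w`. -/
def occCount (v w : List A) : ℕ :=
  ((List.range w.length).filter fun i => decide (v <+: w.drop i)).length

/-- Expected length `E[|ϑ_P^k(a)|]`. -/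
noncomputable def expLen (θ : A → Finset (List A)) (P : A → List A → ℝ)
    (k : ℕ) (a : A) : ℝ :=
  ∑ w ∈ realsIter θ k [a], iterProb θ P k [a] w * (w.length : ℝ)

/-- Expected number of occurrences `E[|ϑ_P^k(a)|_v]`. -/
noncomputable def expCount (θ : A → Finset (List A)) (P : A → List A → ℝ)
    (k : ℕ) (a : A) (v : List A) : ℝ :=
  ∑ w ∈ realsIter θ k [a], iterProb θ P k [a] w * (occCount v w : ℝ)

/-- `μ` is the frequency measure of `(ϑ, P)`: a shift-invariant Borel probability measure
supported on `X_ϑ` whose cylinder values are the expected word frequencies. -/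
def IsFrequencyMeasure [MeasurableSpace A] (θ : A → Finset (List A))
    (P : A → List A → ℝ) (μ : Measure (ℤ → A)) : Prop :=
  IsProbabilityMeasure μ ∧
    (∀ s : Set (ℤ → A), MeasurableSet s → μ (shift ⁻¹' s) = μ s) ∧
    μ (Xtheta θ) = 1 ∧
    ∀ v : List A, Legal θ v → ∀ (m : ℤ) (a : A),
      Tendsto (fun k : ℕ => expCount θ P k a v / expLen θ P k a) atTop
        (nhds ((μ (cylinder v m)).toReal))

/-- The `n`-th entropy sum `∑_{u ∈ L_ϑ^n} -μ[u] log μ[u]`. -/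
noncomputable def entropySeq [MeasurableSpace A] (θ : A → Finset (List A))
    (μ : Measure (ℤ → A)) (n : ℕ) : ℝ :=
  ∑ u ∈ legalWords θ n, Real.negMulLog ((μ (cylinder u 0)).toReal)

/-- The measure-theoretic (Kolmogorov–Sinai) entropy of the shift with respect to `μ`,
computed along cylinder partitions. -/
noncomputable def measEntropy [MeasurableSpace A] (θ : A → Finset (List A))
    (μ : Measure (ℤ → A)) : ℝ :=
  limsup (fun n : ℕ => entropySeq θ μ n / (n : ℝ)) atTop

/-- The topological entropy of the subshift `X_ϑ`. -/
noncomputable def topEntropy (θ : A → Finset (List A)) : ℝ :=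
  limsup (fun n : ℕ => Real.log ((legalWords θ n).card) / (n : ℝ)) atTop

/-- The entropy vector `H_{k,a} = H(ϑ_P^k(a))`. -/
noncomputable def Hvec (θ : A → Finset (List A)) (P : A → List A → ℝ)
    (k : ℕ) (a : A) : ℝ :=
  ∑ w ∈ realsIter θ k [a], Real.negMulLog (iterProb θ P k [a] w)

/-- The inner product `H_k^T R`. -/
noncomputable def HdotR (θ : A → Finset (List A)) (P : A → List A → ℝ)
    (R : A → ℝ) (k : ℕ) : ℝ :=
  ∑ a, Hvec θ P k a * R a

/-- Binary entropy `H(p) = -p log p - (1-p) log (1-p)`. -/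
noncomputable def binEnt (p : ℝ) : ℝ := Real.negMulLog p + Real.negMulLog (1 - p)

/-- Unique realisation paths: concatenation of level-`k` inflation words of the letters of a
legal word is injective. -/
def UniqueRealisationPaths (θ : A → Finset (List A)) : Prop :=
  ∀ v : List A, Legal θ v → ∀ k : ℕ, ∀ f g : Fin v.length → List A,
    (∀ i, f i ∈ realsIter θ k [v.get i]) → (∀ i, g i ∈ realsIter θ k [v.get i]) →
      (List.ofFn f).flatten = (List.ofFn g).flatten → f = g

/-- The disjoint set condition. -/
def DisjointSetCondition (θ : A → Finset (List A)) : Prop :=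
  ∀ (a : A) (k : ℕ), ∀ u ∈ θ a, ∀ v ∈ θ a, u ≠ v →
    ∀ w, w ∈ realsIter θ k u → w ∉ realsIter θ k v

/-- The identical set condition. -/
def IdenticalSetCondition (θ : A → Finset (List A)) : Prop :=
  ∀ (a : A) (k : ℕ), ∀ u ∈ θ a, ∀ v ∈ θ a, realsIter θ k u = realsIter θ k v

/-- Identical production probabilities. -/
def IdenticalProductionProbabilities (θ : A → Finset (List A))
    (P : A → List A → ℝ) : Prop :=
  ∀ a : A, ∀ u ∈ θ a, ∀ v ∈ θ a, ∀ (k : ℕ) (w : List A),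
    iterProb θ P k u w = iterProb θ P k v w

/-- The disjoint set condition for the `k`-th power `ϑ^k`. -/
def DisjointSetConditionPow (θ : A → Finset (List A)) (k : ℕ) : Prop :=
  ∀ (a : A) (j : ℕ), ∀ u ∈ realsIter θ k [a], ∀ v ∈ realsIter θ k [a], u ≠ v →
    ∀ w, w ∈ realsIter θ (k * j) u → w ∉ realsIter θ (k * j) v

/-- The identical set condition for the `k`-th power `ϑ^k`. -/
def IdenticalSetConditionPow (θ : A → Finset (List A)) (k : ℕ) : Prop :=
  ∀ (a : A) (j : ℕ), ∀ u ∈ realsIter θ k [a], ∀ v ∈ realsIter θ k [a],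
    realsIter θ (k * j) u = realsIter θ (k * j) v

/-- Identical production probabilities for the `k`-th power `ϑ^k`. -/
def IdenticalProductionProbabilitiesPow (θ : A → Finset (List A))
    (P : A → List A → ℝ) (k : ℕ) : Prop :=
  ∀ a : A, ∀ u ∈ realsIter θ k [a], ∀ v ∈ realsIter θ k [a], ∀ (j : ℕ) (w : List A),
    iterProb θ P (k * j) u w = iterProb θ P (k * j) v w

/-- Compatibility: all realisations of a letter have the same abelianisation. -/
def Compatible (θ : A → Finset (List A)) : Prop :=
  ∀ a : A, ∀ u ∈ θ a, ∀ v ∈ θ a, ∀ b : A, u.count b = v.count b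

/-- Constant length `ℓ ≥ 2`. -/
def ConstantLength (θ : A → Finset (List A)) (ℓ : ℕ) : Prop :=
  2 ≤ ℓ ∧ ∀ a : A, ∀ w ∈ θ a, w.length = ℓ

/-- The set `ϑ(y)` of bi-infinite sequences obtained by substituting each letter of `y`,
with the image of `y 0` beginning at position `0`. -/
def substSeq (θ : A → Finset (List A)) (y : ℤ → A) : Set (ℤ → A) :=
  {x | ∃ v : ℤ → List A, (∀ j, v j ∈ θ (y j)) ∧
    ∃ p : ℤ → ℤ, p 0 = 0 ∧ (∀ j, p (j + 1) = p j + (v j).length) ∧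
      ∀ (j : ℤ) (t : ℕ) (ht : t < (v j).length), x (p j + (t : ℤ)) = (v j).get ⟨t, ht⟩}

/-- `ϑ(X)` for a set of bi-infinite sequences. -/
def substImage (θ : A → Finset (List A)) (X : Set (ℤ → A)) : Set (ℤ → A) :=
  ⋃ y ∈ X, substSeq θ y

/-- The set `ϑ^m(y)` of bi-infinite sequences. -/
def substSeqPow (θ : A → Finset (List A)) : ℕ → (ℤ → A) → Set (ℤ → A)
  | 0, y => {y}
  | m + 1, y => ⋃ z ∈ substSeq θ y, substSeqPow θ m z

/-- The maximal length of an inflation word of the letter `a` (equals the common length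
when lengths are well-defined). -/
def maxLen (θ : A → Finset (List A)) (a : A) : ℕ := (θ a).sup List.length

/-- Recognisability: every `x ∈ X_ϑ` has a unique inflation-word decomposition. -/
def Recognisable (θ : A → Finset (List A)) : Prop :=
  ∀ x ∈ Xtheta θ, ∃! p : (ℤ → A) × ℕ,
    p.1 ∈ Xtheta θ ∧ p.2 < maxLen θ (p.1 0) ∧
      (fun i => x (i - (p.2 : ℤ))) ∈ substSeq θ p.1

/-- Recognisability of the `m`-th power of a constant length-`ℓ` substitution. -/
def RecognisablePow (θ : A → Finset (List A)) (m ℓ : ℕ) : Prop :=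
  ∀ x ∈ Xtheta θ, ∃! p : (ℤ → A) × ℕ,
    p.1 ∈ Xtheta θ ∧ p.2 < ℓ ^ m ∧
      (fun i => x (i - (p.2 : ℤ))) ∈ substSeqPow θ m p.1

/-- The set `ϑ^m([a])` of exact images of sequences in the cylinder `[a] ⊆ X_ϑ`. -/
def inflCylPow (θ : A → Finset (List A)) (m : ℕ) (a : A) : Set (ℤ → A) :=
  ⋃ y ∈ {w ∈ Xtheta θ | w 0 = a}, substSeqPow θ m y

/-- `r` is a radius of local recognisability for `ϑ^m`. -/
def RecogPropPow (θ : A → Finset (List A)) (m r : ℕ) : Prop :=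
  ∀ (a : A) (x : ℤ → A), x ∈ inflCylPow θ m a → ∀ y ∈ Xtheta θ,
    (∀ t : ℤ, -(r : ℤ) ≤ t → t ≤ (r : ℤ) → x t = y t) → y ∈ inflCylPow θ m a

/-- The recognisability radius `κ(ϑ^m)`. -/
noncomputable def recogRadiusPow (θ : A → Finset (List A)) (m : ℕ) : ℕ :=
  sInf {r | RecogPropPow θ m r}

/-- The recognisability radius `κ(ϑ)`. -/
noncomputable def recogRadius (θ : A → Finset (List A)) : ℕ := recogRadiusPow θ 1

/-- The random word `ϑ_P^n(a)` is (a.s.) completely determined by `ϑ_P^{n+k}(a)`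
in the Markov chain. -/
def DeterminedBy (θ : A → Finset (List A)) (P : A → List A → ℝ)
    (a : A) (n k : ℕ) : Prop :=
  ∀ v₁ v₂ w : List A, v₁ ∈ realsIter θ n [a] → v₂ ∈ realsIter θ n [a] →
    0 < iterProb θ P n [a] v₁ * iterProb θ P k v₁ w →
      0 < iterProb θ P n [a] v₂ * iterProb θ P k v₂ w → v₁ = v₂

/-- The random words `ϑ_P^n(a)` and `ϑ_P^{n+k}(a)` are independent in the Markov chain. -/
def IndepSteps (θ : A → Finset (List A)) (P : A → List A → ℝ)
    (a : A) (n k : ℕ) : Prop :=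
  ∀ v w : List A,
    iterProb θ P n [a] v * iterProb θ P k v w =
      iterProb θ P n [a] v * iterProb θ P (n + k) [a] w

/-- The substitution matrix of a marginal (deterministic) substitution. -/
def marginalM (ρ : A → List A) : Matrix A A ℝ :=
  Matrix.of fun i j => ((ρ j).count i : ℝ)

/-- Geometric compatibility: a single positive left eigenvector with eigenvalue `λ > 1`
for all marginals. -/
def GeometricallyCompatible (θ : A → Finset (List A)) : Prop :=
  ∃ lam : ℝ, 1 < lam ∧ ∃ L : A → ℝ, (∀ a, 0 < L a) ∧
    ∀ ρ : A → List A, (∀ a, ρ a ∈ θ a) → Matrix.vecMul L (marginalM ρ) = lam • L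


section

set_option linter.unusedSectionVars false

theorem wordProb_eq_zero (θ : A → Finset (List A)) (P : A → List A → ℝ) (u w : List A)
    (hw : w ∉ reals θ u) : wordProb θ P u w = 0 := by
  induction u generalizing w with
  | nil => simp_all [reals, wordProb]
  | cons a u ih =>
    rw [wordProb]
    refine Finset.sum_eq_zero fun v hv => ?_
    split_ifs with h
    · obtain ⟨y, rfl⟩ := h
      rw [List.drop_left, ih, mul_zero]
      intro hy
      apply hw
      simp only [reals, Finset.mem_biUnion, Finset.mem_image]
      exact ⟨v, hv, y, hy, rfl⟩
    · simp

theorem iterProb_eq_zero (θ : A → Finset (List A)) (P : A → List A → ℝ) (k : ℕ) (u w : List A)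
    (hw : w ∉ realsIter θ k u) : iterProb θ P k u w = 0 := by
  induction k generalizing u with
  | zero => simp_all [realsIter, iterProb, eq_comm]
  | succ k ih =>
    rw [iterProb]
    refine Finset.sum_eq_zero fun v hv => ?_
    rw [ih, mul_zero]
    intro h
    exact hw (Finset.mem_biUnion.2 ⟨v, hv, h⟩)

theorem wordProb_nonneg {θ : A → Finset (List A)} {P : A → List A → ℝ}
    (hP : IsRandomSubstitution θ P) (u w : List A) : 0 ≤ wordProb θ P u w := by
  induction u generalizing w with
  | nil => rw [wordProb]; split_ifs <;> norm_num
  | cons a u ih =>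
    rw [wordProb]
    refine Finset.sum_nonneg fun v hv => mul_nonneg (hP.2.2.1 a v hv).le ?_
    split_ifs
    · exact ih _
    · exact le_rfl

theorem iterProb_nonneg {θ : A → Finset (List A)} {P : A → List A → ℝ}
    (hP : IsRandomSubstitution θ P) (k : ℕ) (u w : List A) : 0 ≤ iterProb θ P k u w := by
  induction k generalizing u with
  | zero => rw [iterProb]; split_ifs <;> norm_num
  | succ k ih =>
    exact Finset.sum_nonneg fun v _ => mul_nonneg (wordProb_nonneg hP u v) (ih v)

/-- The expectation `E[g(ϑ_P(u))]`. -/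
noncomputable def wordExp (θ : A → Finset (List A)) (P : A → List A → ℝ) (u : List A)
    (g : List A → ℝ) : ℝ :=
  ∑ w ∈ reals θ u, wordProb θ P u w * g w

/-- The expectation `E[g(ϑ_P^k(u))]`. -/
noncomputable def iterExp (θ : A → Finset (List A)) (P : A → List A → ℝ) (k : ℕ) (u : List A)
    (g : List A → ℝ) : ℝ :=
  ∑ w ∈ realsIter θ k u, iterProb θ P k u w * g w

variable {θ : A → Finset (List A)} {P : A → List A → ℝ}

theorem wordExp_nil (g : List A → ℝ) : wordExp θ P [] g = g [] := by
  simp [wordExp, reals, wordProb]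

theorem wordExp_cons (a : A) (u : List A) (g : List A → ℝ) :
    wordExp θ P (a :: u) g = ∑ v ∈ θ a, P a v * wordExp θ P u fun w => g (v ++ w) := by
  simp only [wordExp, wordProb, Finset.sum_mul]
  rw [Finset.sum_comm]
  refine Finset.sum_congr rfl fun v hv => ?_
  have hinj : Function.Injective fun y : List A => v ++ y := fun _ _ h => List.append_cancel_left h
  have hsub : (reals θ u).image (fun y => v ++ y) ⊆ reals θ (a :: u) := fun w hw =>
    Finset.mem_biUnion.2 ⟨v, hv, hw⟩
  rw [← Finset.sum_subset hsub, Finset.sum_image fun _ _ _ _ h => hinj h, Finset.mul_sum]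
  · refine Finset.sum_congr rfl fun y _ => ?_
    simp [mul_assoc]
  · intro w _ hw
    split_ifs with h
    · obtain ⟨y, rfl⟩ := h
      rw [List.drop_left, wordProb_eq_zero]
      · simp
      · exact fun hy => hw (Finset.mem_image_of_mem _ hy)
    · simp

theorem iterExp_zero (u : List A) (g : List A → ℝ) : iterExp θ P 0 u g = g u := by
  simp [iterExp, realsIter, iterProb]

theorem iterExp_succ (k : ℕ) (u : List A) (g : List A → ℝ) :
    iterExp θ P (k + 1) u g = wordExp θ P u fun v => iterExp θ P k v g := by
  simp only [iterExp, wordExp, iterProb, Finset.sum_mul, Finset.mul_sum]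
  rw [Finset.sum_comm]
  refine Finset.sum_congr rfl fun v hv => ?_
  have hsub : realsIter θ k v ⊆ realsIter θ (k + 1) u := fun w hw =>
    Finset.mem_biUnion.2 ⟨v, hv, hw⟩
  rw [← Finset.sum_subset hsub]
  · exact Finset.sum_congr rfl fun y _ => by ring
  · intro w _ hw
    rw [iterProb_eq_zero θ P k v w hw]
    ring

theorem wordExp_comm (u : List A) (k : ℕ) (v : List A) (g : List A → List A → ℝ) :
    wordExp θ P u (fun x => iterExp θ P k v fun y => g x y) =
      iterExp θ P k v fun y => wordExp θ P u fun x => g x y := by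
  simp only [iterExp, wordExp, Finset.mul_sum]
  rw [Finset.sum_comm]
  exact Finset.sum_congr rfl fun y _ => Finset.sum_congr rfl fun x _ => by ring

theorem wordExp_append (u v : List A) (g : List A → ℝ) :
    wordExp θ P (u ++ v) g = wordExp θ P u fun x => wordExp θ P v fun y => g (x ++ y) := by
  induction u generalizing g with
  | nil => simp [wordExp_nil]
  | cons a u ih => simp [wordExp_cons, ih]

theorem iterExp_append (k : ℕ) (u v : List A) (g : List A → ℝ) :
    iterExp θ P k (u ++ v) g =
      iterExp θ P k u fun x => iterExp θ P k v fun y => g (x ++ y) := by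
  induction k generalizing u v g with
  | zero => simp [iterExp_zero]
  | succ k ih =>
    rw [iterExp_succ, wordExp_append, iterExp_succ]
    congr 1; funext x
    simp only [iterExp_succ, ih]
    rw [wordExp_comm]

theorem iterExp_add_iter (m k : ℕ) (u : List A) (g : List A → ℝ) :
    iterExp θ P (m + k) u g = iterExp θ P m u fun v => iterExp θ P k v g := by
  induction m generalizing u with
  | zero => simp [iterExp_zero]
  | succ m ih =>
    rw [Nat.add_right_comm, iterExp_succ, iterExp_succ]
    congr 1; funext x; exact ih x

theorem iterExp_add (k : ℕ) (u : List A) (g g' : List A → ℝ) :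
    iterExp θ P k u (fun w => g w + g' w) = iterExp θ P k u g + iterExp θ P k u g' := by
  simp [iterExp, mul_add, Finset.sum_add_distrib]

theorem iterExp_const_mul (k : ℕ) (u : List A) (c : ℝ) (g : List A → ℝ) :
    iterExp θ P k u (fun w => c * g w) = c * iterExp θ P k u g := by
  simp only [iterExp, Finset.mul_sum]
  exact Finset.sum_congr rfl fun y _ => by ring

theorem iterExp_sum {ι : Type*} (s : Finset ι) (k : ℕ) (u : List A) (g : ι → List A → ℝ) :
    iterExp θ P k u (fun w => ∑ i ∈ s, g i w) = ∑ i ∈ s, iterExp θ P k u (g i) := by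
  simp only [iterExp, Finset.mul_sum]
  exact Finset.sum_comm

theorem wordExp_const (hP : IsRandomSubstitution θ P) (u : List A) (c : ℝ) :
    wordExp θ P u (fun _ => c) = c := by
  induction u with
  | nil => simp [wordExp_nil]
  | cons a u ih => rw [wordExp_cons, ih, ← Finset.sum_mul, hP.2.2.2.2, one_mul]

theorem iterExp_const (hP : IsRandomSubstitution θ P) (k : ℕ) (u : List A) (c : ℝ) :
    iterExp θ P k u (fun _ => c) = c := by
  induction k generalizing u with
  | zero => simp [iterExp_zero]
  | succ k ih => simp only [iterExp_succ, ih]; exact wordExp_const hP u c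

theorem mem_realsIter_of_iterProb_pos {k : ℕ} {u w : List A} (h : 0 < iterProb θ P k u w) :
    w ∈ realsIter θ k u := by
  by_contra hw
  exact h.ne' (iterProb_eq_zero θ P k u w hw)

theorem iterExp_mono (hP : IsRandomSubstitution θ P) (k : ℕ) (u : List A) {g g' : List A → ℝ}
    (h : ∀ w, 0 < iterProb θ P k u w → g w ≤ g' w) : iterExp θ P k u g ≤ iterExp θ P k u g' := by
  refine Finset.sum_le_sum fun w _ => ?_
  rcases (iterProb_nonneg hP k u w).eq_or_lt' with h0 | h0
  · simp [h0]
  · exact mul_le_mul_of_nonneg_left (h w h0) h0.le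

theorem iterExp_additive (hP : IsRandomSubstitution θ P) (k : ℕ) (g : List A → ℝ)
    (hg : ∀ x y, g (x ++ y) = g x + g y) (t : List A) :
    iterExp θ P k t g = (t.map fun b => iterExp θ P k [b] g).sum := by
  induction t with
  | nil =>
    have h := iterExp_append (θ := θ) (P := P) k [] [] g
    simp only [List.append_nil, hg, iterExp_add, iterExp_const hP] at h
    simp only [List.map_nil, List.sum_nil]
    linarith
  | cons b t ih =>
    rw [← List.singleton_append, iterExp_append]
    simp only [hg, iterExp_add, iterExp_const hP, ih]
    simp

theorem sum_map_eq_sum_count (t : List A) (φ : A → ℝ) :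
    (t.map φ).sum = ∑ b, (t.count b : ℝ) * φ b := by
  induction t with
  | nil => simp
  | cons a t ih => simp [List.count_cons, ih, add_mul, Finset.sum_add_distrib, add_comm]

theorem occCount_nil (v : List A) : occCount v [] = 0 := by simp [occCount]

theorem occCount_cons (v : List A) (x : A) (w : List A) :
    occCount v (x :: w) = (if v <+: x :: w then 1 else 0) + occCount v w := by
  rw [occCount, occCount, List.length_cons, List.range_succ_eq_map, List.filter_cons]
  simp only [List.drop_zero, List.filter_map, decide_eq_true_eq]
  have : ((fun i => decide (v <+: List.drop i (x :: w))) ∘ Nat.succ) =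
      fun i => decide (v <+: List.drop i w) := by
    funext i; simp
  rw [this]
  split_ifs <;> simp [add_comm]

theorem occCount_singleton (b : A) (w : List A) : occCount [b] w = w.count b := by
  induction w with
  | nil => simp [occCount]
  | cons x w ih =>
    rw [occCount_cons, ih, List.count_cons]
    by_cases h : b = x
    · simp [h, add_comm]
    · simp [h, Ne.symm h]

theorem expLen_eq (k : ℕ) (a : A) :
    expLen θ P k a = iterExp θ P k [a] fun w => (w.length : ℝ) := rfl

theorem expCount_eq (k : ℕ) (a : A) (v : List A) :
    expCount θ P k a v = iterExp θ P k [a] fun w => (occCount v w : ℝ) := rfl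

theorem Hvec_eq (k : ℕ) (a : A) :
    Hvec θ P k a = iterExp θ P k [a] fun w => -Real.log (iterProb θ P k [a] w) :=
  Finset.sum_congr rfl fun w _ => by simp [Real.negMulLog]

/-- The expectation of a letter-additive functional of `ϑ_P^m(a)`. -/
theorem iterExp_sum_map (m : ℕ) (a : A) (φ : A → ℝ) :
    iterExp θ P m [a] (fun t => (t.map φ).sum) = ∑ b, expCount θ P m a [b] * φ b := by
  simp only [sum_map_eq_sum_count, expCount_eq, occCount_singleton]
  rw [iterExp_sum]
  refine Finset.sum_congr rfl fun b _ => ?_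
  rw [mul_comm, ← iterExp_const_mul]
  simp only [mul_comm]

theorem iterExp_length (hP : IsRandomSubstitution θ P) (k : ℕ) (t : List A) :
    iterExp θ P k t (fun w => (w.length : ℝ)) = (t.map (expLen θ P k)).sum :=
  iterExp_additive hP k _ (by simp) t

theorem expLen_add (hP : IsRandomSubstitution θ P) (m k : ℕ) (a : A) :
    expLen θ P (m + k) a = ∑ b, expCount θ P m a [b] * expLen θ P k b := by
  rw [expLen_eq, iterExp_add_iter]
  simp only [iterExp_length hP]
  exact iterExp_sum_map m a _

theorem expCount_singleton_add (hP : IsRandomSubstitution θ P) (m k : ℕ) (a i : A) :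
    expCount θ P (m + k) a [i] = ∑ b, expCount θ P m a [b] * expCount θ P k b [i] := by
  rw [expCount_eq, iterExp_add_iter, ← iterExp_sum_map]
  congr 1; funext t
  exact iterExp_additive hP k _ (by simp [occCount_singleton]) t

theorem expCount_one (a i : A) : expCount θ P 1 a [i] = substM θ P i a := by
  rw [expCount_eq, iterExp_succ, wordExp_cons]
  simp [wordExp_nil, iterExp_zero, occCount_singleton, substM]

theorem sum_expCount_singleton (k : ℕ) (a : A) :
    ∑ i, expCount θ P k a [i] = expLen θ P k a := by
  have h := iterExp_sum_map (θ := θ) (P := P) k a fun _ => 1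
  simp only [mul_one] at h
  rw [← h, expLen_eq]
  congr 1; funext t; simp

theorem expCount_nonneg (hP : IsRandomSubstitution θ P) (k : ℕ) (a : A) (v : List A) :
    0 ≤ expCount θ P k a v :=
  Finset.sum_nonneg fun w _ => mul_nonneg (iterProb_nonneg hP k [a] w) (Nat.cast_nonneg _)

theorem mem_allWords {n : ℕ} {w : List A} : w ∈ allWords A n ↔ w.length = n := by
  simp only [allWords, Finset.mem_image, Finset.mem_univ, true_and]
  constructor
  · rintro ⟨f, rfl⟩; simp
  · rintro rfl; exact ⟨w.get, List.ofFn_get w⟩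

theorem allWords_zero : allWords A 0 = {[]} := by
  ext w; simp [mem_allWords]

theorem card_allWords (n : ℕ) : (allWords A n).card = Fintype.card A ^ n := by
  rw [allWords, Finset.card_image_of_injective _ List.ofFn_injective]
  simp

theorem sum_allWords_succ (n : ℕ) (g : List A → ℝ) :
    ∑ w ∈ allWords A (n + 1), g w = ∑ a, ∑ w ∈ allWords A n, g (a :: w) := by
  rw [← Finset.sum_product', eq_comm]
  refine Finset.sum_bij (fun x _ => x.1 :: x.2) ?_ ?_ ?_ ?_
  · intro x hx
    simp only [Finset.mem_product, Finset.mem_univ, true_and, mem_allWords] at hx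
    simp [mem_allWords, hx]
  · rintro ⟨a, u⟩ _ ⟨b, v⟩ _ h
    simpa using h
  · intro w hw
    rw [mem_allWords] at hw
    obtain ⟨a, u, rfl⟩ := List.exists_cons_of_length_eq_add_one hw
    exact ⟨(a, u), by simpa [mem_allWords] using hw, rfl⟩
  · intros; rfl

theorem sum_allWords_add (i j : ℕ) (φ ψ : List A → ℝ) :
    ∑ w ∈ allWords A (i + j), φ (w.take i) * ψ (w.drop i) =
      (∑ x ∈ allWords A i, φ x) * ∑ y ∈ allWords A j, ψ y := by
  induction i generalizing φ with
  | zero => simp [allWords_zero, Finset.mul_sum]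
  | succ i ih =>
    rw [Nat.add_right_comm, sum_allWords_succ, sum_allWords_succ, Finset.sum_mul]
    exact Finset.sum_congr rfl fun a _ => by simpa using ih fun x => φ (a :: x)

/-- The total weight of all factorisations of a word into nonempty pieces, where a factorisation
is weighted by the product of the weights `p` of its pieces. -/
noncomputable def parseWeight (p : List A → ℝ) : List A → ℝ
  | [] => 1
  | x :: w => ∑ i : Fin (w.length + 1), p (x :: w.take i) * parseWeight p (w.drop i)
termination_by w => w.length
decreasing_by simp

theorem parseWeight_nonneg {p : List A → ℝ} (hp : ∀ w, 0 ≤ p w) (w : List A) :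
    0 ≤ parseWeight p w := by
  induction h : w.length using Nat.strong_induction_on generalizing w with
  | _ n ih =>
    cases w with
    | nil => simp [parseWeight]
    | cons x w =>
      rw [parseWeight]
      refine Finset.sum_nonneg fun i _ => mul_nonneg (hp _) (ih _ ?_ _ rfl)
      rw [← h]; simp

theorem le_parseWeight_append {p : List A → ℝ} (hp : ∀ w, 0 ≤ p w) {x : List A} (hx : x ≠ [])
    (y : List A) : p x * parseWeight p y ≤ parseWeight p (x ++ y) := by
  obtain ⟨a, x, rfl⟩ := List.exists_cons_of_ne_nil hx
  rw [List.cons_append, parseWeight]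
  have h := Finset.single_le_sum
    (f := fun i : Fin ((x ++ y).length + 1) =>
      p (a :: (x ++ y).take i) * parseWeight p ((x ++ y).drop i))
    (fun i _ => mul_nonneg (hp _) (parseWeight_nonneg hp _))
    (Finset.mem_univ ⟨x.length, by simp⟩)
  simpa using h

theorem sum_parseWeight_le {p : List A → ℝ} (hp : ∀ w, 0 ≤ p w)
    (hsum : ∀ N, ∑ i ∈ Finset.range N, ∑ w ∈ allWords A (i + 1), p w ≤ 1) (L : ℕ) :
    ∑ w ∈ allWords A L, parseWeight p w ≤ 1 := by
  induction L using Nat.strong_induction_on with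
  | _ L ih =>
    cases L with
    | zero => simp [allWords_zero, parseWeight]
    | succ L =>
      have key : ∀ w ∈ allWords A (L + 1), parseWeight p w =
          ∑ i ∈ Finset.range (L + 1), p (w.take (i + 1)) * parseWeight p (w.drop (i + 1)) := by
        intro w hw
        rw [mem_allWords] at hw
        obtain ⟨a, u, rfl⟩ := List.exists_cons_of_length_eq_add_one hw
        obtain rfl : u.length = L := by simpa using hw
        rw [parseWeight, Finset.sum_range]
        simp
      rw [Finset.sum_congr rfl key, Finset.sum_comm]
      refine le_trans (Finset.sum_le_sum fun i hi => ?_) (hsum (L + 1))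
      rw [Finset.mem_range] at hi
      have hL : L + 1 = (i + 1) + (L - i) := by omega
      rw [hL, sum_allWords_add]
      exact mul_le_of_le_one_right (Finset.sum_nonneg fun w _ => hp w) (ih _ (by omega))

/-- The cost of a single letter in the universal code. -/
noncomputable def letterCost (A : Type*) [Fintype A] : ℝ := Real.log (2 * Fintype.card A)

theorem letterCost_nonneg [Nonempty A] : 0 ≤ letterCost A := by
  have h : (1 : ℝ) ≤ Fintype.card A := by exact_mod_cast Fintype.card_pos
  exact Real.log_nonneg (by linarith)

/-- Every subprobability `r` on nonempty words yields a code length function on words for which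
a piece `x` costs `log 2 - log (r x)` and a letter costs `letterCost A`. -/
theorem exists_codeLength [Nonempty A] (r : List A → ℝ) (hr : ∀ w, 0 ≤ r w)
    (hsum : ∀ N, ∑ i ∈ Finset.range N, ∑ w ∈ allWords A (i + 1), r w ≤ 1) :
    ∃ c : List A → ℝ, c [] = 0 ∧ (∀ w, 0 ≤ c w) ∧
      (∀ a w, c (a :: w) ≤ letterCost A + c w) ∧
      (∀ x y, x ≠ [] → 0 < r x → c (x ++ y) ≤ Real.log 2 - Real.log (r x) + c y) ∧
      ∀ L, ∑ w ∈ allWords A L, Real.exp (-c w) ≤ 1 := by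
  have hA : (0 : ℝ) < Fintype.card A := by exact_mod_cast Fintype.card_pos
  set p : List A → ℝ := fun w =>
    r w / 2 + if w.length = 1 then 1 / (2 * (Fintype.card A : ℝ)) else 0 with hpdef
  have hp : ∀ w, 0 ≤ p w := fun w => by
    have := hr w
    simp only [hpdef]
    split_ifs <;> positivity
  have hpr : ∀ w, r w / 2 ≤ p w := fun w => by
    simp only [hpdef]
    split_ifs <;> simp
  have hpl : ∀ a : A, 1 / (2 * (Fintype.card A : ℝ)) ≤ p [a] := fun a => by
    have := hr [a]
    simp only [hpdef, List.length_singleton, if_true]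
    linarith
  have hpsum : ∀ N, ∑ i ∈ Finset.range N, ∑ w ∈ allWords A (i + 1), p w ≤ 1 := by
    intro N
    have h1 : ∀ i, ∑ w ∈ allWords A (i + 1), p w =
        (∑ w ∈ allWords A (i + 1), r w) / 2 + if i = 0 then 1 / 2 else 0 := by
      intro i
      simp only [hpdef, Finset.sum_add_distrib, Finset.sum_div]
      congr 1
      rw [Finset.sum_congr rfl fun w hw => by rw [mem_allWords.1 hw], Finset.sum_const,
        card_allWords]
      rcases Nat.eq_zero_or_pos i with rfl | hi
      · simp
      · simp [hi.ne']
    rw [Finset.sum_congr rfl fun i _ => h1 i, Finset.sum_add_distrib, ← Finset.sum_div]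
    have h2 : ∑ i ∈ Finset.range N, (if i = 0 then (1 / 2 : ℝ) else 0) ≤ 1 / 2 := by
      rw [Finset.sum_ite_eq']
      split_ifs <;> norm_num
    linarith [hsum N]
  have hpos : ∀ w, 0 < parseWeight p w := by
    intro w
    induction w with
    | nil => simp [parseWeight]
    | cons a w ih =>
      have h := le_parseWeight_append hp (List.cons_ne_nil a []) w
      exact lt_of_lt_of_le (mul_pos (lt_of_lt_of_le (by positivity) (hpl a)) ih) h
  have happ : ∀ (x y : List A) (s : ℝ), x ≠ [] → 0 < s → s ≤ p x →
      -Real.log (parseWeight p (x ++ y)) ≤ -Real.log s + -Real.log (parseWeight p y) := by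
    intro x y s hx hs hsp
    have h := le_parseWeight_append hp hx y
    have h2 : s * parseWeight p y ≤ parseWeight p (x ++ y) :=
      le_trans (mul_le_mul_of_nonneg_right hsp (hpos y).le) h
    have h3 := Real.log_le_log (mul_pos hs (hpos y)) h2
    rw [Real.log_mul hs.ne' (hpos y).ne'] at h3
    linarith
  have hexp : ∀ w, Real.exp (- -Real.log (parseWeight p w)) = parseWeight p w := fun w => by
    rw [neg_neg, Real.exp_log (hpos w)]
  refine ⟨fun w => -Real.log (parseWeight p w), by simp [parseWeight], fun w => ?_,
    fun a w => ?_, fun x y hx hrx => ?_, fun L => ?_⟩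
  · have h := sum_parseWeight_le hp hpsum w.length
    have h2 := Finset.single_le_sum (fun w _ => (hpos w).le)
      (mem_allWords.2 (rfl : w.length = w.length)) (f := parseWeight p)
    have := Real.log_nonpos (hpos w).le (h2.trans h)
    simpa using this
  · have h := happ [a] w _ (List.cons_ne_nil a []) (by positivity) (hpl a)
    rw [one_div, Real.log_inv, neg_neg] at h
    exact h
  · have h := happ x y (r x / 2) hx (by positivity) (hpr x)
    rw [Real.log_div hrx.ne' two_ne_zero] at h
    linarith
  · simp only [hexp]
    exact sum_parseWeight_le hp hpsum L

theorem sum_occCount_cons {n : ℕ} (x : A) (w : List A) (g : List A → ℝ) :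
    ∑ v ∈ allWords A n, (occCount v (x :: w) : ℝ) * g v =
      (if n ≤ w.length + 1 then g ((x :: w).take n) else 0) +
        ∑ v ∈ allWords A n, (occCount v w : ℝ) * g v := by
  simp only [occCount_cons, Nat.cast_add, add_mul, Finset.sum_add_distrib]
  congr 1
  split_ifs with h
  · rw [Finset.sum_eq_single ((x :: w).take n)]
    · simp [List.take_prefix]
    · intro v hv hne
      rw [mem_allWords] at hv
      rw [if_neg, Nat.cast_zero, zero_mul]
      intro hpre
      rw [List.prefix_iff_eq_take, hv] at hpre
      exact hne hpre
    · intro hn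
      refine absurd (mem_allWords.2 ?_) hn
      simp [h]
  · refine Finset.sum_eq_zero fun v hv => ?_
    rw [mem_allWords] at hv
    rw [if_neg, Nat.cast_zero, zero_mul]
    intro hpre
    have := hpre.length_le
    simp at this
    omega

theorem sum_occCount_le (n : ℕ) (w : List A) :
    ∑ v ∈ allWords A n, (occCount v w : ℝ) ≤ w.length := by
  induction w with
  | nil => simp [occCount_nil]
  | cons x w ih =>
    have h := sum_occCount_cons (n := n) x w fun _ => 1
    simp only [mul_one] at h
    rw [h, List.length_cons, Nat.cast_add, Nat.cast_one]
    split_ifs <;> linarith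

section CodeLength

variable {c : List A → ℝ} {κ : ℝ}

theorem codeLength_append_le (hc : ∀ a w, c (a :: w) ≤ κ + c w) (x y : List A) :
    c (x ++ y) ≤ x.length * κ + c y := by
  induction x with
  | nil => simp
  | cons a x ih =>
    have := hc a (x ++ y)
    simp only [List.cons_append, List.length_cons, Nat.cast_add, Nat.cast_one]
    linarith

theorem codeLength_le (hc0 : c [] = 0) (hc : ∀ a w, c (a :: w) ≤ κ + c w) (x : List A) :
    c x ≤ x.length * κ := by
  have := codeLength_append_le hc x []
  simpa [hc0] using this

/-- Averaging a block code over all offsets of the blocks. -/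
theorem codeLength_le_sum_windows (hκ : 0 ≤ κ) (hc0 : c [] = 0) (hcn : ∀ w, 0 ≤ c w)
    (hc : ∀ a w, c (a :: w) ≤ κ + c w) {n : ℕ} {cost : List A → ℝ} (hn : 0 < n)
    (hcost : ∀ x y : List A, x.length = n → c (x ++ y) ≤ cost x + c y) (w : List A) :
    n * c w ≤ 2 * n ^ 2 * κ + ∑ v ∈ allWords A n, (occCount v w : ℝ) * cost v := by
  have hS : ∀ w : List A, ∑ j ∈ Finset.range n, c (w.drop j) ≤
      (∑ v ∈ allWords A n, (occCount v w : ℝ) * cost v) + n * κ * (min w.length n : ℕ) := by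
    intro w
    induction w with
    | nil => simp [hc0, occCount_nil]
    | cons x w ih =>
      obtain ⟨n, rfl⟩ : ∃ m, n = m + 1 := ⟨n - 1, by omega⟩
      have h1 : ∑ j ∈ Finset.range (n + 1), c ((x :: w).drop j) =
          (∑ j ∈ Finset.range (n + 1), c (w.drop j)) + c (x :: w) - c (w.drop n) := by
        rw [Finset.sum_range_succ', Finset.sum_range_succ]
        simp only [List.drop_succ_cons, List.drop_zero]
        ring
      rw [h1, sum_occCount_cons]
      have hnκ : 0 ≤ ((n + 1 : ℕ) : ℝ) * κ := by positivity
      split_ifs with h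
      · have h2 := hcost ((x :: w).take (n + 1)) ((x :: w).drop (n + 1)) (by simp; omega)
        rw [List.take_append_drop, List.drop_succ_cons] at h2
        have h3 : ((min w.length (n + 1) : ℕ) : ℝ) ≤ (min (x :: w).length (n + 1) : ℕ) := by
          exact_mod_cast min_le_min (by simp) le_rfl
        have := mul_le_mul_of_nonneg_left h3 hnκ
        linarith
      · have h2 := codeLength_le hc0 hc (x :: w)
        have h3 : ((x :: w).length : ℝ) * κ ≤ (n + 1 : ℕ) * κ := by
          refine mul_le_mul_of_nonneg_right ?_ hκ
          simp only [List.length_cons]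
          exact_mod_cast (by omega : w.length + 1 ≤ n + 1)
        have h4 : min (x :: w).length (n + 1) = min w.length (n + 1) + 1 := by
          simp only [List.length_cons]; omega
        rw [h4]
        push_cast at *
        have := hcn (w.drop n)
        linarith
  have h1 : ∑ j ∈ Finset.range n, c w ≤ ∑ j ∈ Finset.range n, (n * κ + c (w.drop j)) := by
    refine Finset.sum_le_sum fun j hj => ?_
    have h := codeLength_append_le hc (w.take j) (w.drop j)
    rw [List.take_append_drop] at h
    have h2 : ((w.take j).length : ℝ) * κ ≤ n * κ := by
      refine mul_le_mul_of_nonneg_right ?_ hκ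
      have := Finset.mem_range.1 hj
      exact_mod_cast (by simp; omega : (w.take j).length ≤ n)
    linarith
  rw [Finset.sum_add_distrib, Finset.sum_const, Finset.sum_const, Finset.card_range,
    nsmul_eq_mul, nsmul_eq_mul] at h1
  have h2 : (n : ℝ) * κ * (min w.length n : ℕ) ≤ n * κ * n :=
    mul_le_mul_of_nonneg_left (by exact_mod_cast min_le_right _ _) (by positivity)
  have := hS w
  nlinarith

/-- The total code length of all windows of length at most `n` that start inside the word. -/
noncomputable def windowCost (c : List A → ℝ) (n : ℕ) : List A → ℝ
  | [] => 0
  | x :: w => c ((x :: w).take n) + windowCost c n w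

theorem sum_occCount_le_windowCost (hcn : ∀ w, 0 ≤ c w) (n : ℕ) (w : List A) :
    ∑ v ∈ allWords A n, (occCount v w : ℝ) * c v ≤ windowCost c n w := by
  induction w with
  | nil => simp [occCount_nil, windowCost]
  | cons x w ih =>
    rw [sum_occCount_cons, windowCost]
    have := hcn ((x :: w).take n)
    split_ifs <;> linarith

theorem windowCost_append_le (hκ : 0 ≤ κ)
    (hc : ∀ a w, c (a :: w) ≤ κ + c w) (n N : ℕ) (x y : List A) (hx : x.length ≤ N) :
    windowCost c n (x ++ y) ≤ windowCost c n y + x.length * (N * κ) +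
      ∑ j ∈ Finset.range x.length, c (y.take (n - (j + 1))) := by
  induction x with
  | nil => simp
  | cons a x ih =>
    rw [List.length_cons] at hx
    have h1 := ih (by omega)
    have h2 := codeLength_append_le hc ((a :: x).take n) (y.take (n - (x.length + 1)))
    have h3 : (((a :: x).take n).length : ℝ) * κ ≤ N * κ := by
      refine mul_le_mul_of_nonneg_right ?_ hκ
      exact_mod_cast (by simp; omega : ((a :: x).take n).length ≤ N)
    have h4 : (a :: x ++ y).take n = (a :: x).take n ++ y.take (n - (x.length + 1)) := by
      rw [List.take_append, List.length_cons]
    rw [← h4] at h2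
    rw [List.cons_append] at *
    rw [windowCost, List.length_cons, Finset.sum_range_succ, Nat.cast_add, Nat.cast_one]
    linarith

theorem sum_range_sub_succ_add_sum_range (d : ℕ → ℝ) (hd : d 0 = 0) (n j : ℕ) :
    ∑ i ∈ Finset.range j, d (n - (i + 1)) + ∑ l ∈ Finset.range (n - j), d l =
      ∑ l ∈ Finset.range n, d l := by
  induction j with
  | zero => simp
  | succ j ih =>
    rw [← ih, Finset.sum_range_succ]
    rcases Nat.eq_zero_or_pos (n - j) with h | h
    · have h' : n - (j + 1) = 0 := by omega
      rw [h, h', hd]; simp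
    · have h' : n - j = (n - (j + 1)) + 1 := by omega
      rw [h', Finset.sum_range_succ]; ring

/-- The total code length of all windows of length at most `n` meeting the word, including those
that start before it. -/
noncomputable def totalWindowCost (c : List A → ℝ) (n : ℕ) (w : List A) : ℝ :=
  windowCost c n w + ∑ l ∈ Finset.range n, c (w.take l)

theorem totalWindowCost_append_le (hκ : 0 ≤ κ) (hc0 : c [] = 0)
    (hc : ∀ a w, c (a :: w) ≤ κ + c w) (n N : ℕ) (x y : List A) (hx : x.length ≤ N) {s : ℝ}
    (hs0 : 0 ≤ s) (hs : ∀ y, c (x ++ y) ≤ s + c y) :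
    totalWindowCost c n (x ++ y) ≤
      totalWindowCost c n y + 2 * (N * κ) * x.length + n * s := by
  have h1 := windowCost_append_le hκ hc n N x y hx
  have h2 := sum_range_sub_succ_add_sum_range (fun l => c (y.take l)) (by simp [hc0]) n x.length
  have h3 : ∑ l ∈ Finset.range n, c ((x ++ y).take l) ≤
      n * s + x.length * (N * κ) + ∑ l ∈ Finset.range (n - x.length), c (y.take l) := by
    have hN : 0 ≤ (N : ℝ) * κ := by positivity
    have hle : ∀ l ∈ Finset.range x.length, c ((x ++ y).take l) ≤ N * κ := by
      intro l hl
      rw [Finset.mem_range] at hl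
      refine (codeLength_le hc0 hc _).trans (mul_le_mul_of_nonneg_right ?_ hκ)
      exact_mod_cast (by simp; omega : ((x ++ y).take l).length ≤ N)
    rcases le_total x.length n with hxn | hxn
    · have hsplit : n = x.length + (n - x.length) := by omega
      have h4 : ∑ l ∈ Finset.range n, c ((x ++ y).take l) =
          ∑ l ∈ Finset.range x.length, c ((x ++ y).take l) +
            ∑ l ∈ Finset.range (n - x.length), c (x ++ y.take l) := by
        conv_lhs => rw [hsplit, Finset.sum_range_add]
        simp [List.take_append, List.take_of_length_le]
      have h5 := Finset.sum_le_sum hle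
      have h6 : ∑ l ∈ Finset.range (n - x.length), c (x ++ y.take l) ≤
          ∑ l ∈ Finset.range (n - x.length), (s + c (y.take l)) :=
        Finset.sum_le_sum fun l _ => hs _
      rw [Finset.sum_add_distrib, Finset.sum_const, Finset.card_range, nsmul_eq_mul] at h6
      rw [Finset.sum_const, Finset.card_range, nsmul_eq_mul] at h5
      have h7 : ((n - x.length : ℕ) : ℝ) * s ≤ n * s :=
        mul_le_mul_of_nonneg_right (by exact_mod_cast Nat.sub_le _ _) hs0
      linarith
    · have h5 : ∑ l ∈ Finset.range n, c ((x ++ y).take l) ≤ ∑ l ∈ Finset.range n, N * κ :=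
        Finset.sum_le_sum fun l hl => hle l (Finset.range_mono hxn hl)
      rw [Finset.sum_const, Finset.card_range, nsmul_eq_mul] at h5
      have h6 : (n : ℝ) * (N * κ) ≤ x.length * (N * κ) :=
        mul_le_mul_of_nonneg_right (by exact_mod_cast hxn) hN
      rw [Nat.sub_eq_zero_of_le hxn]
      have : 0 ≤ (n : ℝ) * s := by positivity
      simp only [Finset.range_zero, Finset.sum_empty]
      linarith
  unfold totalWindowCost
  linarith

end CodeLength

theorem reals_append {u v x y : List A} (hx : x ∈ reals θ u) (hy : y ∈ reals θ v) :
    x ++ y ∈ reals θ (u ++ v) := by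
  induction u generalizing x with
  | nil =>
    obtain rfl : x = [] := by simpa [reals] using hx
    simpa using hy
  | cons a u ih =>
    simp only [reals, Finset.mem_biUnion, Finset.mem_image] at hx
    obtain ⟨s, hs, z, hz, rfl⟩ := hx
    simp only [List.cons_append, reals, Finset.mem_biUnion, Finset.mem_image]
    exact ⟨s, hs, z ++ y, ih hz, by simp⟩

theorem realsIter_append {k : ℕ} {u v x y : List A} (hx : x ∈ realsIter θ k u)
    (hy : y ∈ realsIter θ k v) : x ++ y ∈ realsIter θ k (u ++ v) := by
  induction k generalizing u v with
  | zero =>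
    simp only [realsIter, Finset.mem_singleton] at *
    rw [hx, hy]
  | succ k ih =>
    simp only [realsIter, Finset.mem_biUnion] at *
    obtain ⟨x', hx', hx⟩ := hx
    obtain ⟨y', hy', hy⟩ := hy
    exact ⟨x' ++ y', reals_append hx' hy', ih hx hy⟩

theorem realsIter_nil (k : ℕ) : realsIter θ k [] = {[]} := by
  induction k with
  | zero => simp [realsIter]
  | succ k ih => simp [realsIter, reals, ih]

theorem sum_iterProb (hP : IsRandomSubstitution θ P) (k : ℕ) (u : List A) :
    ∑ w ∈ realsIter θ k u, iterProb θ P k u w = 1 := by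
  have h := iterExp_const hP k u 1
  simpa [iterExp] using h

theorem sum_iterProb_le (hP : IsRandomSubstitution θ P) (k : ℕ) (u : List A)
    (s : Finset (List A)) : ∑ w ∈ s, iterProb θ P k u w ≤ 1 := by
  rw [← sum_iterProb hP k u]
  calc ∑ w ∈ s, iterProb θ P k u w ≤ ∑ w ∈ s ∪ realsIter θ k u, iterProb θ P k u w :=
        Finset.sum_le_sum_of_subset_of_nonneg Finset.subset_union_left
          fun w _ _ => iterProb_nonneg hP k u w
    _ = ∑ w ∈ realsIter θ k u, iterProb θ P k u w :=
        (Finset.sum_subset Finset.subset_union_right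
          fun w _ hw => iterProb_eq_zero θ P k u w hw).symm

theorem realsIter_nonempty (hP : IsRandomSubstitution θ P) (k : ℕ) (u : List A) :
    (realsIter θ k u).Nonempty := by
  rw [Finset.nonempty_iff_ne_empty]
  intro h
  have := sum_iterProb hP k u
  rw [h] at this
  simp at this

theorem length_le_of_mem_realsIter {C : ℕ} (hC : ∀ a, ∀ w ∈ θ a, w.length ≤ C) {k : ℕ}
    {u w : List A} (hw : w ∈ realsIter θ k u) : w.length ≤ C ^ k * u.length := by
  have h1 : ∀ u w : List A, w ∈ reals θ u → w.length ≤ C * u.length := by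
    intro u
    induction u with
    | nil => intro w hw; simp_all [reals]
    | cons a u ih =>
      intro w hw
      simp only [reals, Finset.mem_biUnion, Finset.mem_image] at hw
      obtain ⟨s, hs, z, hz, rfl⟩ := hw
      have := hC a s hs
      have := ih z hz
      simp only [List.length_append, List.length_cons, mul_add, mul_one]
      omega
  induction k generalizing u with
  | zero => simp_all [realsIter]
  | succ k ih =>
    simp only [realsIter, Finset.mem_biUnion] at hw
    obtain ⟨v, hv, hw⟩ := hw
    calc w.length ≤ C ^ k * v.length := ih hw
      _ ≤ C ^ k * (C * u.length) := Nat.mul_le_mul_left _ (h1 u v hv)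
      _ = C ^ (k + 1) * u.length := by ring

theorem le_length_of_mem_realsIter (hθ : ∀ a, ∀ w ∈ θ a, w ≠ []) {k : ℕ}
    {u w : List A} (hw : w ∈ realsIter θ k u) : u.length ≤ w.length := by
  have h1 : ∀ u w : List A, w ∈ reals θ u → u.length ≤ w.length := by
    intro u
    induction u with
    | nil => intro w hw; simp
    | cons a u ih =>
      intro w hw
      simp only [reals, Finset.mem_biUnion, Finset.mem_image] at hw
      obtain ⟨s, hs, z, hz, rfl⟩ := hw
      have := List.length_pos_iff.2 (hθ a s hs)
      have := ih z hz
      simp only [List.length_append, List.length_cons]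
      omega
  induction k generalizing u with
  | zero => simp_all [realsIter]
  | succ k ih =>
    simp only [realsIter, Finset.mem_biUnion] at hw
    obtain ⟨v, hv, hw⟩ := hw
    exact (h1 u v hv).trans (ih hw)

/-- Gibbs' inequality for the random word `ϑ_P^k(u)`. -/
theorem entropy_add_iterExp_log_le (hP : IsRandomSubstitution θ P) (k : ℕ) (u : List A)
    {Z : List A → ℝ} (hZ : ∀ x, 0 < Z x) :
    iterExp θ P k u (fun x => -Real.log (iterProb θ P k u x)) +
      iterExp θ P k u (fun x => Real.log (Z x)) ≤
        Real.log (∑ x ∈ realsIter θ k u, Z x) := by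
  set T := ∑ x ∈ realsIter θ k u, Z x with hT
  have hTpos : 0 < T := Finset.sum_pos (fun x _ => hZ x) (realsIter_nonempty hP k u)
  rw [← iterExp_add, ← sub_nonpos, ← iterExp_const hP k u (Real.log T), sub_eq_add_neg,
    ← neg_one_mul, ← iterExp_const_mul, ← iterExp_add]
  have h : ∀ x ∈ realsIter θ k u, iterProb θ P k u x *
      (-Real.log (iterProb θ P k u x) + Real.log (Z x) + -1 * Real.log T) ≤
        Z x / T - iterProb θ P k u x := by
    intro x _
    rcases (iterProb_nonneg hP k u x).eq_or_lt' with h0 | h0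
    · rw [h0]
      have := hZ x
      simp only [zero_mul, sub_zero]
      positivity
    · have h1 : -Real.log (iterProb θ P k u x) + Real.log (Z x) + -1 * Real.log T =
          Real.log (Z x / (iterProb θ P k u x * T)) := by
        rw [Real.log_div (hZ x).ne' (by positivity), Real.log_mul h0.ne' hTpos.ne']
        ring
      rw [h1]
      have h2 := Real.log_le_sub_one_of_pos
        (div_pos (hZ x) (mul_pos h0 hTpos))
      calc _ ≤ iterProb θ P k u x * (Z x / (iterProb θ P k u x * T) - 1) :=
            mul_le_mul_of_nonneg_left h2 h0.le
        _ = _ := by field_simp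
  refine (Finset.sum_le_sum h).trans ?_
  rw [Finset.sum_sub_distrib, ← Finset.sum_div, sum_iterProb hP, ← hT, div_self hTpos.ne', sub_self]

/-- A word is the concatenation of an inflation word of length less than `N` and another word in
at most `N` ways. -/
theorem sum_sum_append_le {N k : ℕ} {b : A} {t : List A}
    (hN : ∀ x ∈ realsIter θ k [b], x.length < N) {q : List A → ℝ} (hq : ∀ w, 0 < q w) :
    ∑ x ∈ realsIter θ k [b], ∑ y ∈ realsIter θ k t, q (x ++ y) ≤
      N * ∑ w ∈ realsIter θ k (b :: t), q w := by
  rw [← Finset.sum_product',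
    ← Finset.sum_fiberwise_of_maps_to (s := realsIter θ k [b] ×ˢ realsIter θ k t)
      (t := Finset.range N) (g := fun z => z.1.length)
      (fun z hz => Finset.mem_range.2 (hN z.1 (Finset.mem_product.1 hz).1))]
  have h : ∀ j ∈ Finset.range N,
      ∑ z ∈ realsIter θ k [b] ×ˢ realsIter θ k t with z.1.length = j, q (z.1 ++ z.2) ≤
        ∑ w ∈ realsIter θ k (b :: t), q w := by
    intro j _
    rw [← Finset.sum_image (f := q) (g := fun z : List A × List A => z.1 ++ z.2)]
    · refine Finset.sum_le_sum_of_subset_of_nonneg ?_ fun w _ _ => (hq w).le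
      intro w hw
      simp only [Finset.mem_image, Finset.mem_filter, Finset.mem_product] at hw
      obtain ⟨z, ⟨⟨h1, h2⟩, _⟩, rfl⟩ := hw
      exact realsIter_append h1 h2
    · rintro ⟨x, y⟩ h1 ⟨x', y'⟩ h2 heq
      simp only [Finset.coe_filter, Set.mem_ofPred_eq] at h1 h2
      obtain ⟨rfl, rfl⟩ := List.append_inj heq (h1.2.trans h2.2.symm)
      rfl
  refine (Finset.sum_le_sum h).trans ?_
  simp

/-- The sum of the letter entropies is bounded by any code length, up to the cost of the
cutting points. -/
theorem sum_Hvec_le (hP : IsRandomSubstitution θ P) {N k : ℕ}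
    (hN : ∀ b, ∀ x ∈ realsIter θ k [b], x.length < N) (t : List A) {q : List A → ℝ}
    (hq : ∀ w, 0 < q w) :
    (t.map (Hvec θ P k)).sum ≤ iterExp θ P k t (fun w => -Real.log (q w)) +
      t.length * Real.log N + Real.log (∑ w ∈ realsIter θ k t, q w) := by
  induction t generalizing q with
  | nil =>
    have h : iterProb θ P k ([] : List A) [] = 1 := by
      have := sum_iterProb hP k []
      simpa [realsIter_nil] using this
    simp [iterExp, realsIter_nil, h]
  | cons b t ih =>
    set Z : List A → ℝ := fun x => ∑ y ∈ realsIter θ k t, q (x ++ y) with hZdef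
    have hZ : ∀ x, 0 < Z x := fun x =>
      Finset.sum_pos (fun y _ => hq _) (realsIter_nonempty hP k t)
    have hNpos : (0 : ℝ) < N := by
      obtain ⟨x, hx⟩ := realsIter_nonempty hP k [b]
      exact_mod_cast (Nat.zero_le _).trans_lt (hN b x hx)
    have h1 : iterExp θ P k [b] (fun _ => (t.map (Hvec θ P k)).sum) ≤ iterExp θ P k [b]
        (fun x => (iterExp θ P k t (fun y => -Real.log (q (x ++ y))) +
          t.length * Real.log N) + Real.log (Z x)) :=
      iterExp_mono hP k [b] fun x _ => ih fun y => hq (x ++ y)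
    rw [iterExp_const hP, iterExp_add, iterExp_add, iterExp_const hP,
      ← iterExp_append k [b] t (fun w => -Real.log (q w)), List.singleton_append] at h1
    have h2 := entropy_add_iterExp_log_le hP k [b] hZ
    rw [← Hvec_eq] at h2
    have hWpos : 0 < ∑ w ∈ realsIter θ k (b :: t), q w :=
      Finset.sum_pos (fun w _ => hq w) (realsIter_nonempty hP k _)
    have h3 : Real.log (∑ x ∈ realsIter θ k [b], Z x) ≤
        Real.log N + Real.log (∑ w ∈ realsIter θ k (b :: t), q w) := by
      rw [← Real.log_mul hNpos.ne' hWpos.ne']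
      exact Real.log_le_log (Finset.sum_pos (fun x _ => hZ x) (realsIter_nonempty hP k _))
        (sum_sum_append_le (hN b) hq)
    simp only [List.map_cons, List.sum_cons, List.length_cons, Nat.cast_add, Nat.cast_one]
    linarith

/-- `F` is the word frequency function of `ϑ_P`. -/
def IsWordFrequency (θ : A → Finset (List A)) (P : A → List A → ℝ) (F : List A → ℝ) : Prop :=
  ∀ (v : List A) (a : A),
    Tendsto (fun k : ℕ => expCount θ P k a v / expLen θ P k a) atTop (nhds (F v))

theorem one_le_expLen (hP : IsRandomSubstitution θ P) (k : ℕ) (a : A) : 1 ≤ expLen θ P k a := by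
  rw [expLen_eq, ← iterExp_const hP k [a] 1]
  refine iterExp_mono hP k [a] fun w hw => ?_
  have := le_length_of_mem_realsIter hP.2.1 (mem_realsIter_of_iterProb_pos hw)
  exact_mod_cast this

theorem expLen_pos (hP : IsRandomSubstitution θ P) (k : ℕ) (a : A) : 0 < expLen θ P k a :=
  zero_lt_one.trans_le (one_le_expLen hP k a)

theorem sum_expCount_mul (k : ℕ) (a : A) (s : Finset (List A)) (g : List A → ℝ) :
    ∑ v ∈ s, expCount θ P k a v * g v =
      iterExp θ P k [a] fun w => ∑ v ∈ s, (occCount v w : ℝ) * g v := by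
  rw [iterExp_sum]
  refine Finset.sum_congr rfl fun v _ => ?_
  rw [expCount_eq, mul_comm, ← iterExp_const_mul]
  simp only [mul_comm]

variable {F : List A → ℝ}

theorem IsWordFrequency.nonneg (hP : IsRandomSubstitution θ P) [Nonempty A]
    (hF : IsWordFrequency θ P F) (v : List A) : 0 ≤ F v :=
  ge_of_tendsto' (hF v (Classical.arbitrary A)) fun _ =>
    div_nonneg (expCount_nonneg hP _ _ _) (expLen_pos hP _ _).le

theorem IsWordFrequency.tendsto_sum (hF : IsWordFrequency θ P F) (a : A) (s : Finset (List A))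
    (g : List A → ℝ) :
    Tendsto (fun k => (∑ v ∈ s, expCount θ P k a v * g v) / expLen θ P k a) atTop
      (nhds (∑ v ∈ s, F v * g v)) := by
  have h := tendsto_finsetSum s fun v _ => (hF v a).mul_const (g v)
  refine h.congr fun k => ?_
  rw [Finset.sum_div]
  exact Finset.sum_congr rfl fun v _ => by ring

theorem IsWordFrequency.sum_le_one (hP : IsRandomSubstitution θ P) [Nonempty A]
    (hF : IsWordFrequency θ P F) (n : ℕ) : ∑ v ∈ allWords A n, F v ≤ 1 := by
  have h := hF.tendsto_sum (Classical.arbitrary A) (allWords A n) fun _ => 1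
  simp only [mul_one] at h
  refine le_of_tendsto' h fun k => ?_
  rw [div_le_one (expLen_pos hP _ _)]
  have h2 := sum_expCount_mul (θ := θ) (P := P) k (Classical.arbitrary A) (allWords A n) fun _ => 1
  simp only [mul_one] at h2
  rw [h2, expLen_eq]
  exact iterExp_mono hP _ _ fun w _ => sum_occCount_le n w

theorem IsWordFrequency.tendsto_letter (hF : IsWordFrequency θ P F) (a : A) (φ : A → ℝ) :
    Tendsto (fun m => (∑ b, expCount θ P m a [b] * φ b) / expLen θ P m a) atTop
      (nhds (∑ b, F [b] * φ b)) := by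
  have h := tendsto_finsetSum Finset.univ fun b _ => (hF [b] a).mul_const (φ b)
  refine h.congr fun k => ?_
  rw [Finset.sum_div]
  exact Finset.sum_congr rfl fun v _ => by ring

theorem IsWordFrequency.sum_letter (hP : IsRandomSubstitution θ P) [Nonempty A]
    (hF : IsWordFrequency θ P F) : ∑ b, F [b] = 1 := by
  have h := hF.tendsto_letter (Classical.arbitrary A) fun _ => 1
  simp only [mul_one, sum_expCount_singleton] at h
  refine tendsto_nhds_unique h (tendsto_const_nhds.congr fun k => ?_)
  rw [div_self (expLen_pos hP _ _).ne']

/-- Nonnegative eigenvectors of the substitution matrix are proportional to the vector of letter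
frequencies. -/
theorem IsWordFrequency.eq_of_eigenvector (hP : IsRandomSubstitution θ P)
    (hF : IsWordFrequency θ P F) {g : A → ℝ} {ρ : ℝ} (hg : ∀ a, 0 ≤ g a) (hg1 : 0 < ∑ a, g a)
    (hMg : ∀ i, ∑ a, substM θ P i a * g a = ρ * g i) (i : A) : g i = F [i] * ∑ a, g a := by
  have hpow : ∀ k i, ∑ a, expCount θ P k a [i] * g a = ρ ^ k * g i := by
    intro k
    induction k with
    | zero =>
      intro i
      simp [expCount_eq, iterExp_zero, occCount_singleton, List.count_singleton]
    | succ k ih =>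
      intro i
      simp only [Nat.add_comm k 1, expCount_singleton_add hP, expCount_one, Finset.sum_mul]
      rw [Finset.sum_comm]
      calc _ = ∑ b, expCount θ P k b [i] * ∑ a, substM θ P b a * g a := by
            refine Finset.sum_congr rfl fun b _ => ?_
            rw [Finset.mul_sum]
            exact Finset.sum_congr rfl fun a _ => by ring
        _ = ρ * ∑ b, expCount θ P k b [i] * g b := by
            rw [Finset.mul_sum]
            exact Finset.sum_congr rfl fun b _ => by rw [hMg]; ring
        _ = _ := by rw [ih]; ring
  have hlen : ∀ k, ∑ a, expLen θ P k a * g a = ρ ^ k * ∑ a, g a := by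
    intro k
    simp only [← sum_expCount_singleton, Finset.sum_mul]
    rw [Finset.sum_comm, Finset.mul_sum]
    exact Finset.sum_congr rfl fun i _ => hpow k i
  have hlenpos : ∀ k, 0 < ρ ^ k * ∑ a, g a := by
    intro k
    rw [← hlen]
    refine hg1.trans_le (Finset.sum_le_sum fun a _ => ?_)
    exact le_mul_of_one_le_left (hg a) (one_le_expLen hP k a)
  have hclose : ∀ ε > 0, |g i - F [i] * ∑ a, g a| ≤ ε * ∑ a, g a := by
    intro ε hε
    have hev : ∀ᶠ k in atTop, ∀ a, |expCount θ P k a [i] / expLen θ P k a - F [i]| < ε := by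
      rw [eventually_all]
      intro a
      have := Metric.tendsto_nhds.1 (hF [i] a) ε hε
      simpa [Real.dist_eq] using this
    obtain ⟨k, hk⟩ := hev.exists
    have hρ : 0 < ρ ^ k := pos_of_mul_pos_left (hlenpos k) hg1.le
    have h1 : ρ ^ k * (g i - F [i] * ∑ a, g a) =
        ∑ a, (expLen θ P k a * g a) * (expCount θ P k a [i] / expLen θ P k a - F [i]) := by
      have h2 : ∀ a, (expLen θ P k a * g a) * (expCount θ P k a [i] / expLen θ P k a - F [i]) =
          expCount θ P k a [i] * g a - F [i] * (expLen θ P k a * g a) := by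
        intro a
        have := (expLen_pos hP k a).ne'
        field_simp
      simp only [h2, Finset.sum_sub_distrib]
      rw [← Finset.mul_sum, hpow, hlen]
      ring
    have h3 : |ρ ^ k * (g i - F [i] * ∑ a, g a)| ≤ ρ ^ k * (ε * ∑ a, g a) := by
      rw [h1]
      refine (Finset.abs_sum_le_sum_abs _ _).trans ?_
      have : ρ ^ k * (ε * ∑ a, g a) = ∑ a, (expLen θ P k a * g a) * ε := by
        rw [← Finset.sum_mul, hlen]; ring
      rw [this]
      refine Finset.sum_le_sum fun a _ => ?_
      have h0 : 0 ≤ expLen θ P k a * g a := mul_nonneg (expLen_pos hP k a).le (hg a)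
      rw [abs_mul, abs_of_nonneg h0]
      exact mul_le_mul_of_nonneg_left (hk a).le h0
    rw [abs_mul, abs_of_pos hρ] at h3
    exact le_of_mul_le_mul_left h3 hρ
  have hzero : |g i - F [i] * ∑ a, g a| ≤ 0 := by
    refine le_of_forall_pos_le_add fun ε hε => ?_
    have := hclose (ε / ∑ a, g a) (div_pos hε hg1)
    rwa [div_mul_cancel₀ _ hg1.ne', ← zero_add ε] at this
  exact sub_eq_zero.1 (abs_nonpos_iff.1 hzero)

/-- The mean length `∑_b F(b) E[|ϑ_P^k(b)|]`. -/
noncomputable def meanLen (θ : A → Finset (List A)) (P : A → List A → ℝ) (F : List A → ℝ)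
    (k : ℕ) : ℝ :=
  ∑ b, F [b] * expLen θ P k b

/-- The letter frequencies form a Perron–Frobenius eigenvector. -/
theorem IsWordFrequency.exists_eigenvalue (hP : IsRandomSubstitution θ P) [Nonempty A]
    (hF : IsWordFrequency θ P F) (hE : IsExpanding θ P) :
    ∃ lam : ℝ, 1 < lam ∧ (∀ i, ∑ a, substM θ P i a * F [a] = lam * F [i]) ∧
      ∀ k, meanLen θ P F k = lam ^ k := by
  obtain ⟨lam, hlam, R, hR, hMR⟩ := hE
  have hMR' : ∀ i, ∑ a, substM θ P i a * R a = lam * R i := fun i => congrFun hMR i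
  have hsum : 0 < ∑ a, R a := Finset.sum_pos (fun a _ => hR a) Finset.univ_nonempty
  have hRF := hF.eq_of_eigenvector hP (fun a => (hR a).le) hsum hMR'
  have heig : ∀ i, ∑ a, substM θ P i a * F [a] = lam * F [i] := by
    intro i
    refine mul_right_cancel₀ hsum.ne' ?_
    rw [mul_assoc, ← hRF, ← hMR', Finset.sum_mul]
    exact Finset.sum_congr rfl fun a _ => by rw [mul_assoc, ← hRF]
  refine ⟨lam, hlam, heig, fun k => ?_⟩
  induction k with
  | zero => simp [meanLen, expLen_eq, iterExp_zero, hF.sum_letter hP]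
  | succ k ih =>
    rw [pow_succ', ← ih, meanLen, meanLen, Finset.mul_sum]
    simp only [Nat.add_comm k 1, expLen_add hP, expCount_one, Finset.mul_sum]
    rw [Finset.sum_comm]
    refine Finset.sum_congr rfl fun b _ => ?_
    rw [← mul_assoc, ← heig, Finset.sum_mul]
    exact Finset.sum_congr rfl fun a _ => by ring

theorem IsWordFrequency.one_le_meanLen (hP : IsRandomSubstitution θ P) [Nonempty A]
    (hF : IsWordFrequency θ P F) (k : ℕ) : 1 ≤ meanLen θ P F k := by
  rw [← hF.sum_letter hP]
  exact Finset.sum_le_sum fun b _ => le_mul_of_one_le_right (hF.nonneg hP _) (one_le_expLen hP k b)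

theorem IsWordFrequency.tendsto_letter_shift (hP : IsRandomSubstitution θ P) [Nonempty A]
    (hF : IsWordFrequency θ P F) (a : A) (k : ℕ) (φ : A → ℝ) :
    Tendsto (fun m => (∑ b, expCount θ P m a [b] * φ b) / expLen θ P (m + k) a) atTop
      (nhds ((∑ b, F [b] * φ b) / meanLen θ P F k)) := by
  have h1 := hF.tendsto_letter a φ
  have h2 := hF.tendsto_letter a (expLen θ P k)
  have h3 := h1.div h2 (zero_lt_one.trans_le (hF.one_le_meanLen hP k)).ne'
  refine h3.congr fun m => ?_
  simp only [Pi.div_apply]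
  rw [← expLen_add hP]
  have := (expLen_pos hP m a).ne'
  have := (expLen_pos hP (m + k) a).ne'
  field_simp

theorem IsWordFrequency.tendsto_linear_div_expLen (hP : IsRandomSubstitution θ P) [Nonempty A]
    (hF : IsWordFrequency θ P F) (hE : IsExpanding θ P) (a : A) :
    Tendsto (fun m : ℕ => ((m : ℝ) + 1) / expLen θ P m a) atTop (nhds 0) := by
  obtain ⟨lam, hlam, -, hmean⟩ := hF.exists_eigenvalue hP hE
  have hpos : ∀ m : ℕ, 0 < ((m : ℝ) + 1) / expLen θ P m a := fun m =>
    div_pos (by positivity) (expLen_pos hP m a)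
  refine Summable.tendsto_atTop_zero ?_
  refine summable_of_ratio_test_tendsto_lt_one (l := 1 * (1 / lam))
    (by rw [one_mul, div_lt_one (by linarith)]; exact hlam)
    (Eventually.of_forall fun m => (hpos m).ne') ?_
  have h1 := hF.tendsto_letter_shift hP a 1 fun _ => 1
  simp only [mul_one, sum_expCount_singleton, hF.sum_letter hP, hmean, pow_one] at h1
  have h2 : Tendsto (fun m : ℕ => (((m + 1 : ℕ) : ℝ) + 1) / ((m : ℝ) + 1)) atTop (nhds 1) := by
    have h3 := (tendsto_one_div_add_atTop_nhds_zero_nat (𝕜 := ℝ)).const_add 1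
    rw [add_zero] at h3
    refine h3.congr fun m => ?_
    have : (m : ℝ) + 1 ≠ 0 := by positivity
    push_cast
    field_simp
  refine (h2.mul h1).congr fun m => ?_
  rw [Real.norm_of_nonneg (hpos _).le, Real.norm_of_nonneg (hpos _).le]
  have := (expLen_pos hP m a).ne'
  have := (expLen_pos hP (m + 1) a).ne'
  have : (m : ℝ) + 1 ≠ 0 := by positivity
  field_simp

theorem negMulLog_le_mul_add_exp {x : ℝ} (hx : 0 ≤ x) (c : ℝ) :
    Real.negMulLog x ≤ x * c + Real.exp (-c) := by
  rcases hx.eq_or_lt with rfl | hx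
  · simpa using (Real.exp_pos _).le
  · have h := Real.add_one_le_exp (-c - Real.log x)
    rw [Real.exp_sub, Real.exp_log hx, le_div_iff₀ hx] at h
    rw [Real.negMulLog]
    nlinarith

theorem sum_range_sum_allWords (N : ℕ) (g : List A → ℝ) :
    ∑ i ∈ Finset.range N, ∑ w ∈ allWords A (i + 1), g w =
      ∑ w ∈ (Finset.range N).biUnion fun i => allWords A (i + 1), g w := by
  rw [Finset.sum_biUnion]
  intro i _ j _ hij
  rw [Function.onFun, Finset.disjoint_left]
  intro w hi hj
  rw [mem_allWords] at hi hj
  omega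

/-- A code that describes concatenations of realisations of `ϑ_P^k` at a cost close to their
entropies. -/
theorem exists_codeLength_iterProb [Nonempty A] (hP : IsRandomSubstitution θ P) (k : ℕ) :
    ∃ c : List A → ℝ, c [] = 0 ∧ (∀ w, 0 ≤ c w) ∧ (∀ a w, c (a :: w) ≤ letterCost A + c w) ∧
      (∀ b x y, 0 < iterProb θ P k [b] x →
        c (x ++ y) ≤ letterCost A - Real.log (iterProb θ P k [b] x) + c y) ∧
      ∀ L, ∑ w ∈ allWords A L, Real.exp (-c w) ≤ 1 := by
  have hcard : (0 : ℝ) < Fintype.card A := by exact_mod_cast Fintype.card_pos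
  obtain ⟨c, hc0, hcn, hc, hcr, hsum⟩ := exists_codeLength (A := A)
    (fun w => (∑ b, iterProb θ P k [b] w) / Fintype.card A)
    (fun w => div_nonneg (Finset.sum_nonneg fun b _ => iterProb_nonneg hP _ _ _) hcard.le)
    (fun N => by
      rw [sum_range_sum_allWords, ← Finset.sum_div, Finset.sum_comm, div_le_one hcard]
      exact (Finset.sum_le_sum fun b _ => sum_iterProb_le hP k [b] _).trans (by simp))
  refine ⟨c, hc0, hcn, hc, fun b x y hx => ?_, hsum⟩
  have hxne : x ≠ [] := by
    have := le_length_of_mem_realsIter hP.2.1 (mem_realsIter_of_iterProb_pos hx)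
    rintro rfl
    simp at this
  have hle : iterProb θ P k [b] x ≤ ∑ b, iterProb θ P k [b] x :=
    Finset.single_le_sum (f := fun b => iterProb θ P k [b] x)
      (fun b _ => iterProb_nonneg hP _ _ _) (Finset.mem_univ b)
  have hpos : 0 < ∑ b, iterProb θ P k [b] x := hx.trans_le hle
  have h := hcr x y hxne (div_pos hpos hcard)
  have hlog := Real.log_le_log hx hle
  rw [Real.log_div hpos.ne' hcard.ne'] at h
  have hκ : letterCost A = Real.log 2 + Real.log (Fintype.card A) :=
    Real.log_mul two_ne_zero hcard.ne'
  linarith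

theorem iterProb_le_one (hP : IsRandomSubstitution θ P) (k : ℕ) (u w : List A) :
    iterProb θ P k u w ≤ 1 := by
  simpa using sum_iterProb_le hP k u {w}

theorem iterExp_totalWindowCost_le [Nonempty A] (hP : IsRandomSubstitution θ P) {C k : ℕ}
    (hC : ∀ a, ∀ w ∈ θ a, w.length ≤ C) {c : List A → ℝ} (hc0 : c [] = 0)
    (hc : ∀ a w, c (a :: w) ≤ letterCost A + c w)
    (hcr : ∀ b x y, 0 < iterProb θ P k [b] x →
        c (x ++ y) ≤ letterCost A - Real.log (iterProb θ P k [b] x) + c y) (n : ℕ)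
    (t : List A) :
    iterExp θ P k t (totalWindowCost c n) ≤
      (t.map fun b => 2 * ((C ^ k : ℕ) * letterCost A) * expLen θ P k b +
        n * (Hvec θ P k b + letterCost A)).sum := by
  induction t with
  | nil =>
    have h1 : iterExp θ P k [] (totalWindowCost c n) =
        iterExp θ P k [] fun _ => totalWindowCost c n [] :=
      Finset.sum_congr rfl fun w hw => by
        rw [realsIter_nil, Finset.mem_singleton] at hw
        rw [hw]
    rw [h1, iterExp_const hP]
    simp [totalWindowCost, windowCost, hc0]
  | cons b t ih =>
    rw [← List.singleton_append, iterExp_append, List.map_append, List.sum_append]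
    set T := iterExp θ P k t (totalWindowCost c n)
    have hstep : (iterExp θ P k [b] fun x => iterExp θ P k t fun y => totalWindowCost c n (x ++ y)) ≤
        iterExp θ P k [b] fun x => (T + 2 * ((C ^ k : ℕ) * letterCost A) * (x.length : ℝ)) +
          n * (-Real.log (iterProb θ P k [b] x) + letterCost A) := by
      refine iterExp_mono hP _ _ fun x hx => ?_
      have hlen : x.length ≤ C ^ k := by
        simpa using length_le_of_mem_realsIter hC (mem_realsIter_of_iterProb_pos hx)
      have hs : 0 ≤ letterCost A - Real.log (iterProb θ P k [b] x) := by
        have := Real.log_nonpos hx.le (iterProb_le_one hP k [b] x)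
        have := letterCost_nonneg (A := A)
        linarith
      refine (iterExp_mono hP k t fun y _ => totalWindowCost_append_le letterCost_nonneg hc0 hc
        n (C ^ k) x y hlen hs fun y => hcr b x y hx).trans (le_of_eq ?_)
      rw [iterExp_add, iterExp_add, iterExp_const hP, iterExp_const hP]
      ring
    refine hstep.trans ?_
    rw [iterExp_add, iterExp_add, iterExp_const_mul, iterExp_const_mul, iterExp_add,
      iterExp_const hP, iterExp_const hP, ← Hvec_eq, ← expLen_eq]
    simp only [List.map_cons, List.map_nil, List.sum_cons, List.sum_nil]
    linarith

/-- Upper bound for the block entropies of the word frequencies. -/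
theorem IsWordFrequency.blockEntropy_le [Nonempty A] {F : List A → ℝ}
    (hP : IsRandomSubstitution θ P)
    (hF : IsWordFrequency θ P F) {C : ℕ} (hC : ∀ a, ∀ w ∈ θ a, w.length ≤ C) (k n : ℕ) :
    ∑ v ∈ allWords A n, Real.negMulLog (F v) ≤ 1 + 2 * ((C ^ k : ℕ) * letterCost A) +
      n * ((∑ b, F [b] * (Hvec θ P k b + letterCost A)) / meanLen θ P F k) := by
  obtain ⟨c, hc0, hcn, hc, hcr, hsum⟩ := exists_codeLength_iterProb hP k
  let a : A := Classical.arbitrary A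
  have hlim1 := (hF.tendsto_sum a (allWords A n) c).comp (tendsto_add_atTop_nat k)
  have hlim2 := hF.tendsto_letter_shift hP a k
    fun b => 2 * ((C ^ k : ℕ) * letterCost A) * expLen θ P k b + n * (Hvec θ P k b + letterCost A)
  have hval : (∑ b, F [b] * (2 * ((C ^ k : ℕ) * letterCost A) * expLen θ P k b +
      n * (Hvec θ P k b + letterCost A))) / meanLen θ P F k = 2 * ((C ^ k : ℕ) * letterCost A) +
      n * ((∑ b, F [b] * (Hvec θ P k b + letterCost A)) / meanLen θ P F k) := by
    have hm := (zero_lt_one.trans_le (hF.one_le_meanLen hP k)).ne'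
    have h1 : (∑ b, F [b] * (2 * ((C ^ k : ℕ) * letterCost A) * expLen θ P k b +
        n * (Hvec θ P k b + letterCost A))) = 2 * ((C ^ k : ℕ) * letterCost A) * meanLen θ P F k +
        n * ∑ b, F [b] * (Hvec θ P k b + letterCost A) := by
      rw [meanLen, Finset.mul_sum, Finset.mul_sum, ← Finset.sum_add_distrib]
      exact Finset.sum_congr rfl fun b _ => by ring
    rw [h1]
    field_simp
  rw [hval] at hlim2
  have hcost : ∑ v ∈ allWords A n, F v * c v ≤ 2 * ((C ^ k : ℕ) * letterCost A) +
      n * ((∑ b, F [b] * (Hvec θ P k b + letterCost A)) / meanLen θ P F k) := by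
    refine le_of_tendsto_of_tendsto' hlim1 hlim2 fun m => ?_
    refine div_le_div_of_nonneg_right ?_ (expLen_pos hP _ _).le
    rw [sum_expCount_mul, iterExp_add_iter, ← iterExp_sum_map]
    refine iterExp_mono hP _ _ fun t _ => ?_
    refine le_trans (iterExp_mono hP _ _ fun w _ => ?_)
      (iterExp_totalWindowCost_le hP hC hc0 hc hcr n t)
    exact (sum_occCount_le_windowCost hcn n w).trans
      (le_add_of_nonneg_right (Finset.sum_nonneg fun _ _ => hcn _))
  have hent : ∑ v ∈ allWords A n, Real.negMulLog (F v) ≤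
      ∑ v ∈ allWords A n, (F v * c v + Real.exp (-c v)) :=
    Finset.sum_le_sum fun v _ => negMulLog_le_mul_add_exp (hF.nonneg hP v) _
  rw [Finset.sum_add_distrib] at hent
  linarith [hsum n]

theorem log_pow_add_one_le (C j : ℕ) :
    Real.log ((C ^ j : ℕ) + 1 : ℝ) ≤ ((j : ℝ) + 1) * Real.log ((C : ℝ) + 2) := by
  have h : C ^ j + 1 ≤ (C + 2) ^ (j + 1) := by
    have h1 : C ^ j ≤ (C + 2) ^ j := Nat.pow_le_pow_left (by omega) j
    have h2 : 1 ≤ (C + 2) ^ j := Nat.one_le_pow _ _ (by omega)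
    rw [pow_succ]
    nlinarith
  have h3 : (((C ^ j : ℕ) + 1 : ℝ)) ≤ ((C : ℝ) + 2) ^ (j + 1) := by exact_mod_cast h
  have h4 := Real.log_le_log (by positivity) h3
  rw [Real.log_pow] at h4
  exact_mod_cast h4

/-- A code that describes blocks of length `n` at a cost close to the logarithm of their
frequencies. -/
theorem IsWordFrequency.exists_codeLength [Nonempty A] {F : List A → ℝ}
    (hP : IsRandomSubstitution θ P) (hF : IsWordFrequency θ P F) {n : ℕ} (hn : 0 < n) :
    ∃ c cost : List A → ℝ, c [] = 0 ∧ (∀ w, 0 ≤ c w) ∧ (∀ a w, c (a :: w) ≤ letterCost A + c w) ∧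
      (∀ x y, x.length = n → c (x ++ y) ≤ cost x + c y) ∧
      (∀ L, ∑ w ∈ allWords A L, Real.exp (-c w) ≤ 1) ∧
      ∀ v, F v * cost v ≤ 2 * Real.log 2 * F v + Real.negMulLog (F v) := by
  have hcard : (0 : ℝ) < Fintype.card A := by exact_mod_cast Fintype.card_pos
  set δ : ℝ := ((Fintype.card A : ℝ) ^ n)⁻¹ with hδ
  have hδpos : 0 < δ := by positivity
  have hρpos : ∀ v, 0 < (F v + δ) / 2 := fun v => by
    have := hF.nonneg hP v
    positivity
  have hρsum : ∑ v ∈ allWords A n, (F v + δ) / 2 ≤ 1 := by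
    have h1 := hF.sum_le_one hP n
    have h2 : ∑ _v ∈ allWords A n, δ = 1 := by
      rw [Finset.sum_const, card_allWords, nsmul_eq_mul, hδ]
      push_cast
      exact mul_inv_cancel₀ (by positivity)
    rw [← Finset.sum_div, Finset.sum_add_distrib, h2]
    linarith
  obtain ⟨c, hc0, hcn, hc, hcr, hsum⟩ := RandomSubstitutionTheory.exists_codeLength (A := A)
    (fun v => if v.length = n then (F v + δ) / 2 else 0)
    (fun w => by
      split_ifs
      exacts [(hρpos w).le, le_rfl])
    (fun N => by
      rw [sum_range_sum_allWords, ← Finset.sum_filter]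
      refine le_trans (Finset.sum_le_sum_of_subset_of_nonneg (fun w hw => ?_)
        fun w _ _ => (hρpos w).le) hρsum
      exact mem_allWords.2 (Finset.mem_filter.1 hw).2)
  refine ⟨c, fun v => Real.log 2 - Real.log ((F v + δ) / 2), hc0, hcn, hc, fun x y hx => ?_,
    hsum, fun v => ?_⟩
  · have hx0 : x ≠ [] := by
      rintro rfl
      simp at hx
      omega
    simpa [hx] using hcr x y hx0 (by simp [hx, hρpos])
  · rcases (hF.nonneg hP v).eq_or_lt with h | h
    · simp [← h]
    · have h1 := Real.log_le_log h (le_add_of_nonneg_right hδpos.le : F v ≤ F v + δ)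
      dsimp only
      rw [Real.log_div (by positivity) two_ne_zero, Real.negMulLog]
      nlinarith

theorem sum_realsIter_exp_le {C : ℕ} (hC : ∀ a, ∀ w ∈ θ a, w.length ≤ C) {c : List A → ℝ}
    (hsum : ∀ L, ∑ w ∈ allWords A L, Real.exp (-c w) ≤ 1) (k : ℕ) (t : List A) :
    ∑ w ∈ realsIter θ k t, Real.exp (-c w) ≤ (C ^ k * t.length : ℕ) + 1 := by
  have hsub : realsIter θ k t ⊆
      (Finset.range (C ^ k * t.length + 1)).biUnion fun L => allWords A L := by
    intro w hw
    have := length_le_of_mem_realsIter hC hw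
    exact Finset.mem_biUnion.2 ⟨w.length, Finset.mem_range.2 (by omega), mem_allWords.2 rfl⟩
  refine (Finset.sum_le_sum_of_subset_of_nonneg hsub fun _ _ _ => (Real.exp_pos _).le).trans ?_
  rw [Finset.sum_biUnion]
  · refine (Finset.sum_le_sum fun L _ => hsum L).trans ?_
    simp
  · intro i _ j _ hij
    rw [Function.onFun, Finset.disjoint_left]
    intro w hi hj
    rw [mem_allWords] at hi hj
    omega

theorem sum_Hvec_le_codeLength (hP : IsRandomSubstitution θ P) {C : ℕ}
    (hC : ∀ a, ∀ w ∈ θ a, w.length ≤ C) {c : List A → ℝ}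
    (hsum : ∀ L, ∑ w ∈ allWords A L, Real.exp (-c w) ≤ 1) (k m : ℕ) (a : A) :
    ∑ b, expCount θ P m a [b] * (Hvec θ P k b - Real.log ((C ^ k : ℕ) + 1)) ≤
      iterExp θ P (m + k) [a] c + (((m + k : ℕ) : ℝ) + 1) * Real.log ((C : ℝ) + 2) := by
  rw [← iterExp_sum_map, iterExp_add_iter,
    ← iterExp_const hP m [a] ((((m + k : ℕ) : ℝ) + 1) * Real.log ((C : ℝ) + 2)), ← iterExp_add]
  refine iterExp_mono hP _ _ fun t ht => ?_
  have hlen : t.length ≤ C ^ m := by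
    simpa using length_le_of_mem_realsIter hC (mem_realsIter_of_iterProb_pos ht)
  have hN : ∀ b, ∀ x ∈ realsIter θ k [b], x.length < C ^ k + 1 := fun b x hx => by
    have := length_le_of_mem_realsIter hC hx
    simp at this
    omega
  have h := sum_Hvec_le hP hN t (q := fun w => Real.exp (-c w)) fun w => Real.exp_pos _
  simp only [Real.log_exp, neg_neg] at h
  have hpos : 0 < ∑ w ∈ realsIter θ k t, Real.exp (-c w) :=
    Finset.sum_pos (fun _ _ => Real.exp_pos _) (realsIter_nonempty hP k t)
  have hlog : Real.log (∑ w ∈ realsIter θ k t, Real.exp (-c w)) ≤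
      (((m + k : ℕ) : ℝ) + 1) * Real.log ((C : ℝ) + 2) := by
    refine le_trans (Real.log_le_log hpos ?_) (log_pow_add_one_le C (m + k))
    refine (sum_realsIter_exp_le hC hsum k t).trans ?_
    have : C ^ k * t.length ≤ C ^ (m + k) := by
      rw [pow_add, mul_comm]
      exact Nat.mul_le_mul_right _ hlen
    exact_mod_cast Nat.succ_le_succ this
  have hmap : ∀ t : List A, (t.map fun b => Hvec θ P k b - Real.log ((C ^ k : ℕ) + 1)).sum =
      (t.map (Hvec θ P k)).sum - t.length * Real.log ((C ^ k + 1 : ℕ) : ℝ) := by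
    intro t
    induction t with
    | nil => simp
    | cons b t ih =>
      simp only [List.map_cons, List.sum_cons, ih, List.length_cons]
      push_cast
      ring
  rw [hmap]
  linarith

/-- Lower bound for the block entropies of the word frequencies. -/
theorem IsWordFrequency.le_blockEntropy [Nonempty A] {F : List A → ℝ}
    (hP : IsRandomSubstitution θ P) (hF : IsWordFrequency θ P F) (hE : IsExpanding θ P) {C : ℕ}
    (hC : ∀ a, ∀ w ∈ θ a, w.length ≤ C) (k : ℕ) {n : ℕ} (hn : 0 < n) :
    n * ((∑ b, F [b] * (Hvec θ P k b - Real.log ((C ^ k : ℕ) + 1))) / meanLen θ P F k) ≤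
      ∑ v ∈ allWords A n, Real.negMulLog (F v) + 2 * Real.log 2 := by
  obtain ⟨c, cost, hc0, hcn, hc, hcost, hsum, hFcost⟩ := hF.exists_codeLength hP hn
  let a : A := Classical.arbitrary A
  have hκ := letterCost_nonneg (A := A)
  set K : ℝ := 2 * n ^ 2 * letterCost A + n * Real.log ((C : ℝ) + 2) with hK
  have hlim1 := (hF.tendsto_letter_shift hP a k
    fun b => Hvec θ P k b - Real.log ((C ^ k : ℕ) + 1)).const_mul (n : ℝ)
  have hlim2 := ((hF.tendsto_sum a (allWords A n) cost).comp (tendsto_add_atTop_nat k)).add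
    (((hF.tendsto_linear_div_expLen hP hE a).comp (tendsto_add_atTop_nat k)).const_mul K)
  rw [mul_zero, add_zero] at hlim2
  have hle := le_of_tendsto_of_tendsto' hlim1 hlim2 fun m => by
    simp only [Function.comp_apply]
    rw [← mul_div_assoc, ← mul_div_assoc, ← add_div]
    refine div_le_div_of_nonneg_right ?_ (expLen_pos hP _ _).le
    have h1 := mul_le_mul_of_nonneg_left (sum_Hvec_le_codeLength hP hC hsum k m a)
      (Nat.cast_nonneg n)
    have h2 : n * iterExp θ P (m + k) [a] c ≤ 2 * n ^ 2 * letterCost A +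
        ∑ v ∈ allWords A n, expCount θ P (m + k) a v * cost v := by
      rw [← iterExp_const_mul, sum_expCount_mul,
        ← iterExp_const hP (m + k) [a] (2 * n ^ 2 * letterCost A), ← iterExp_add]
      exact iterExp_mono hP _ _ fun w _ =>
        codeLength_le_sum_windows hκ hc0 hcn hc hn hcost w
    have h3 : 0 ≤ 2 * (n : ℝ) ^ 2 * letterCost A * ((m + k : ℕ) : ℝ) := by positivity
    rw [hK]
    nlinarith
  have hfin : ∑ v ∈ allWords A n, F v * cost v ≤
      2 * Real.log 2 * ∑ v ∈ allWords A n, F v + ∑ v ∈ allWords A n, Real.negMulLog (F v) := by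
    rw [Finset.mul_sum, ← Finset.sum_add_distrib]
    exact Finset.sum_le_sum fun v _ => hFcost v
  have hlog2 : 0 ≤ 2 * Real.log 2 := by positivity
  have := mul_le_mul_of_nonneg_left (hF.sum_le_one hP n) hlog2
  linarith

/-- The word frequencies read off from a measure on the subshift. -/
noncomputable def wordFreq [MeasurableSpace A] (θ : A → Finset (List A)) (ν : Measure (ℤ → A))
    (v : List A) : ℝ :=
  letI := Classical.decPred (Legal θ)
  if Legal θ v then (ν (cylinder v 0)).toReal else 0

theorem expCount_eq_zero {v : List A} (hv : ¬ Legal θ v) (k : ℕ) (a : A) :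
    expCount θ P k a v = 0 := by
  refine Finset.sum_eq_zero fun w hw => ?_
  have : occCount v w = 0 := by
    rw [occCount, List.length_eq_zero_iff, List.filter_eq_nil_iff]
    intro i _
    simp only [decide_eq_true_eq]
    exact fun h => hv ⟨a, k, w, hw, h.isInfix.trans (List.drop_suffix i w).isInfix⟩
  simp [this]

theorem IsFrequencyMeasure.isWordFrequency [MeasurableSpace A] {ν : Measure (ℤ → A)}
    (hν : IsFrequencyMeasure θ P ν) : IsWordFrequency θ P (wordFreq θ ν) := by
  intro v a
  by_cases hv : Legal θ v
  · simpa [wordFreq, hv] using hν.2.2.2 v hv 0 a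
  · simp [wordFreq, hv, expCount_eq_zero]

theorem entropySeq_eq [MeasurableSpace A] (ν : Measure (ℤ → A)) (n : ℕ) :
    entropySeq θ ν n = ∑ v ∈ allWords A n, Real.negMulLog (wordFreq θ ν v) := by
  rw [entropySeq, legalWords, Finset.sum_filter]
  refine Finset.sum_congr rfl fun v _ => ?_
  by_cases hv : Legal θ v <;> simp [wordFreq, hv]

theorem limsup_mem_Icc_of_linear_bounds {e : ℕ → ℝ} {L U c d : ℝ}
    (hL : ∀ n : ℕ, 0 < n → n * L ≤ e n + c) (hU : ∀ n : ℕ, 0 < n → e n ≤ d + n * U) :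
    L ≤ limsup (fun n : ℕ => e n / n) atTop ∧ limsup (fun n : ℕ => e n / n) atTop ≤ U := by
  have hlow : Tendsto (fun n : ℕ => L - c / n) atTop (nhds L) := by
    simpa using (tendsto_const_div_atTop_nhds_zero_nat c).const_sub L
  have hup : Tendsto (fun n : ℕ => d / n + U) atTop (nhds U) := by
    simpa using (tendsto_const_div_atTop_nhds_zero_nat d).add_const U
  have hle1 : ∀ᶠ n : ℕ in atTop, L - c / n ≤ e n / n := by
    filter_upwards [eventually_gt_atTop 0] with n hn
    have hn' : (0 : ℝ) < n := by exact_mod_cast hn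
    have := hL n hn
    rw [sub_le_iff_le_add, ← add_div, le_div_iff₀ hn']
    linarith
  have hle2 : ∀ᶠ n : ℕ in atTop, e n / n ≤ d / n + U := by
    filter_upwards [eventually_gt_atTop 0] with n hn
    have hn' : (0 : ℝ) < n := by exact_mod_cast hn
    have := hU n hn
    rw [div_add' _ _ _ hn'.ne', div_le_div_iff_of_pos_right hn']
    linarith
  constructor
  · rw [← hlow.limsup_eq]
    exact limsup_le_limsup hle1 hlow.isCoboundedUnder_le (hup.isBoundedUnder_le.mono_le hle2)
  · rw [← hup.limsup_eq]
    refine limsup_le_limsup hle2 ?_ hup.isBoundedUnder_le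
    exact (hlow.isBoundedUnder_ge.mono_ge hle1).isCoboundedUnder_le

theorem measEntropy_bounds [MeasurableSpace A] [Nonempty A] (hP : IsRandomSubstitution θ P)
    {ν : Measure (ℤ → A)} (hν : IsFrequencyMeasure θ P ν) (hE : IsExpanding θ P) {C : ℕ}
    (hC : ∀ a, ∀ w ∈ θ a, w.length ≤ C) (k : ℕ) :
    (∑ b, wordFreq θ ν [b] * (Hvec θ P k b - Real.log ((C ^ k : ℕ) + 1))) /
        meanLen θ P (wordFreq θ ν) k ≤ measEntropy θ ν ∧
      measEntropy θ ν ≤ (∑ b, wordFreq θ ν [b] * (Hvec θ P k b + letterCost A)) /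
        meanLen θ P (wordFreq θ ν) k := by
  refine limsup_mem_Icc_of_linear_bounds (c := 2 * Real.log 2)
    (d := 1 + 2 * ((C ^ k : ℕ) * letterCost A)) (fun n hn => ?_) fun n _ => ?_
  · rw [entropySeq_eq]
    exact hν.isWordFrequency.le_blockEntropy hP hE hC k hn
  · rw [entropySeq_eq]
    exact hν.isWordFrequency.blockEntropy_le hP hC k n

/-- The entropy is approximated by the normalised entropies of the inflation words, with an error
that vanishes as the level grows. -/
theorem abs_measEntropy_sub_le [MeasurableSpace A] [Nonempty A] (hP : IsRandomSubstitution θ P)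
    {ν : Measure (ℤ → A)} (hν : IsFrequencyMeasure θ P ν) (hE : IsExpanding θ P) {C : ℕ}
    (hC : ∀ a, ∀ w ∈ θ a, w.length ≤ C) (k : ℕ) :
    |measEntropy θ ν - (∑ b, wordFreq θ ν [b] * Hvec θ P k b) / meanLen θ P (wordFreq θ ν) k| ≤
      (((k : ℝ) + 1) * (Real.log ((C : ℝ) + 2) + letterCost A)) /
        meanLen θ P (wordFreq θ ν) k := by
  have hF := hν.isWordFrequency
  obtain ⟨h1, h2⟩ := measEntropy_bounds hP hν hE hC k
  have hm : 0 < meanLen θ P (wordFreq θ ν) k := zero_lt_one.trans_le (hF.one_le_meanLen hP k)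
  simp only [mul_sub, mul_add, Finset.sum_sub_distrib, Finset.sum_add_distrib, ← Finset.sum_mul,
    hF.sum_letter hP, one_mul, sub_div, add_div] at h1 h2
  have hκ := letterCost_nonneg (A := A)
  have hlogC : 0 ≤ Real.log ((C : ℝ) + 2) := Real.log_nonneg (by linarith [C.cast_nonneg (α := ℝ)])
  have hk : (0 : ℝ) ≤ k := k.cast_nonneg
  have h3 := div_le_div_of_nonneg_right (log_pow_add_one_le C k) hm.le
  have h4 : letterCost A / meanLen θ P (wordFreq θ ν) k ≤
      ((k : ℝ) + 1) * letterCost A / meanLen θ P (wordFreq θ ν) k :=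
    div_le_div_of_nonneg_right (le_mul_of_one_le_left hκ (by linarith)) hm.le
  have h5 : 0 ≤ ((k : ℝ) + 1) * Real.log ((C : ℝ) + 2) / meanLen θ P (wordFreq θ ν) k := by
    positivity
  have h6 : 0 ≤ ((k : ℝ) + 1) * letterCost A / meanLen θ P (wordFreq θ ν) k := by positivity
  rw [mul_add, add_div, abs_le]
  constructor <;> linarith

theorem continuous_wordProb (u w : List A) : Continuous fun P => wordProb θ P u w := by
  induction u generalizing w with
  | nil => exact continuous_const
  | cons a u ih =>
    simp only [wordProb]
    refine continuous_finsetSum _ fun v _ => ?_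
    have hP : Continuous fun P : A → List A → ℝ => P a v := by fun_prop
    split_ifs
    · exact hP.mul (ih _)
    · exact hP.mul continuous_const

theorem continuous_iterProb (k : ℕ) (u w : List A) :
    Continuous fun P => iterProb θ P k u w := by
  induction k generalizing u with
  | zero => exact continuous_const
  | succ k ih =>
    exact continuous_finsetSum _ fun v _ => (continuous_wordProb u v).mul (ih v)

theorem continuous_Hvec (k : ℕ) (a : A) : Continuous fun P => Hvec θ P k a :=
  continuous_finsetSum _ fun w _ =>
    Real.continuous_negMulLog.comp (continuous_iterProb k [a] w)

theorem continuous_expLen (k : ℕ) (a : A) : Continuous fun P => expLen θ P k a :=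
  continuous_finsetSum _ fun w _ => (continuous_iterProb k [a] w).mul continuous_const

theorem continuous_substM (i j : A) : Continuous fun P => substM θ P i j := by
  simp only [substM, Matrix.of_apply]
  fun_prop

theorem IsWordFrequency.letter_mem_stdSimplex [Nonempty A] {F : List A → ℝ}
    (hP : IsRandomSubstitution θ P) (hF : IsWordFrequency θ P F) :
    (fun b => F [b]) ∈ stdSimplex ℝ A :=
  ⟨fun b => hF.nonneg hP [b], hF.sum_letter hP⟩

/-- The letter frequencies depend continuously on the probability data. -/
theorem continuousWithinAt_letterFrequency [Nonempty A]
    (hE : ∀ P, IsRandomSubstitution θ P → IsExpanding θ P)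
    {F : (A → List A → ℝ) → List A → ℝ}
    (hF : ∀ P, IsRandomSubstitution θ P → IsWordFrequency θ P (F P))
    (hP : IsRandomSubstitution θ P) :
    ContinuousWithinAt (fun Q b => F Q [b]) {Q | IsRandomSubstitution θ Q} P := by
  refine (isCompact_stdSimplex ℝ A).tendsto_nhds_of_unique_mapClusterPt
    (eventually_nhdsWithin_of_forall fun Q hQ => (hF Q hQ).letter_mem_stdSimplex hQ) ?_
  intro g hg hcl
  obtain ⟨U, hU, hUg⟩ := mapClusterPt_iff_ultrafilter.1 hcl
  have hUP : (U : Filter (A → List A → ℝ)) ≤ nhds P := hU.trans nhdsWithin_le_nhds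
  have hlim : ∀ a, Tendsto (fun Q => F Q [a]) U (nhds (g a)) := tendsto_pi_nhds.1 hUg
  have hM : ∀ i, Tendsto (fun Q => ∑ a, substM θ Q i a * F Q [a]) U
      (nhds (∑ a, substM θ P i a * g a)) := fun i =>
    tendsto_finsetSum _ fun a _ =>
      (((continuous_substM i a).tendsto P).mono_left hUP).mul (hlim a)
  have hMsum := tendsto_finsetSum Finset.univ fun i (_ : i ∈ Finset.univ) => hM i
  have heig : ∀ i, ∑ a, substM θ P i a * g a = (∑ j, ∑ a, substM θ P j a * g a) * g i := by
    intro i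
    refine tendsto_nhds_unique (hM i) ((hMsum.mul (hlim i)).congr' ?_)
    have hmem : ∀ᶠ Q in (U : Filter (A → List A → ℝ)), IsRandomSubstitution θ Q :=
      hU self_mem_nhdsWithin
    filter_upwards [hmem] with Q hQ
    obtain ⟨lam, -, hlam, -⟩ := (hF Q hQ).exists_eigenvalue hQ (hE Q hQ)
    simp only [hlam, ← Finset.mul_sum, (hF Q hQ).sum_letter hQ, mul_one]
  funext i
  have := (hF P hP).eq_of_eigenvector hP hg.1 (hg.2.symm ▸ zero_lt_one) heig i
  rwa [hg.2, mul_one] at this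

theorem continuousWithinAt_meanLen [Nonempty A]
    (hE : ∀ P, IsRandomSubstitution θ P → IsExpanding θ P)
    {F : (A → List A → ℝ) → List A → ℝ}
    (hF : ∀ P, IsRandomSubstitution θ P → IsWordFrequency θ P (F P))
    (hP : IsRandomSubstitution θ P) (k : ℕ) :
    ContinuousWithinAt (fun Q => meanLen θ Q (F Q) k) {Q | IsRandomSubstitution θ Q} P :=
  tendsto_finsetSum _ fun b _ =>
    (continuousWithinAt_pi.1 (continuousWithinAt_letterFrequency hE hF hP) b).mul
      (continuous_expLen k b).continuousWithinAt

theorem IsWordFrequency.tendsto_div_meanLen [Nonempty A] {F : List A → ℝ}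
    (hP : IsRandomSubstitution θ P) (hF : IsWordFrequency θ P F) (hE : IsExpanding θ P) (K : ℝ) :
    Tendsto (fun k : ℕ => ((k : ℝ) + 1) * K / meanLen θ P F k) atTop (nhds 0) := by
  obtain ⟨lam, hlam, -, hmean⟩ := hF.exists_eigenvalue hP hE
  have h := ((tendsto_pow_const_div_const_pow_of_one_lt 1 hlam).add
    (tendsto_pow_const_div_const_pow_of_one_lt 0 hlam)).mul_const K
  rw [add_zero, zero_mul] at h
  refine h.congr fun k => ?_
  rw [hmean, pow_one, pow_zero]
  ring

theorem continuousWithinAt_of_approx {X : Type*} [TopologicalSpace X] {s : Set X} {x : X}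
    (hx : x ∈ s) {h : X → ℝ} {G E : ℕ → X → ℝ}
    (hG : ∀ k, ContinuousWithinAt (G k) s x) (hE : ∀ k, ContinuousWithinAt (E k) s x)
    (hle : ∀ k, ∀ y ∈ s, |h y - G k y| ≤ E k y)
    (hE0 : Tendsto (fun k => E k x) atTop (nhds 0)) : ContinuousWithinAt h s x := by
  refine Metric.tendsto_nhds.2 fun ε hε => ?_
  obtain ⟨k, hk⟩ := (hE0.eventually (gt_mem_nhds (show 0 < ε / 3 by positivity))).exists
  filter_upwards [(hE k).eventually (gt_mem_nhds hk),
    Metric.tendsto_nhds.1 (hG k) (ε / 3) (by positivity), self_mem_nhdsWithin] with y hy1 hy2 hy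
  have h1 := abs_le.1 (hle k y hy)
  have h2 := abs_le.1 (hle k x hx)
  rw [Real.dist_eq] at hy2 ⊢
  have h3 := abs_lt.1 hy2
  rw [abs_lt]
  constructor <;> linarith

end

theorem statement2 {A : Type*} [Fintype A] [DecidableEq A] [MeasurableSpace A]
    (θ : A → Finset (List A))
    (hθ : ∀ a, (θ a).Nonempty) (hθ' : ∀ a, ∀ w ∈ θ a, w ≠ [])
    (hprim : ∀ P : A → List A → ℝ, IsRandomSubstitution θ P → IsPrimitive θ P)
    (hexp : ∀ P : A → List A → ℝ, IsRandomSubstitution θ P → IsExpanding θ P)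
    (μ : (A → List A → ℝ) → Measure (ℤ → A))
    (hμ : ∀ P : A → List A → ℝ, IsRandomSubstitution θ P → IsFrequencyMeasure θ P (μ P)) :
    ContinuousOn (fun P : A → List A → ℝ => measEntropy θ (μ P))
      {P | IsRandomSubstitution θ P} := by
  rcases isEmpty_or_nonempty A with hA | hA
  · exact Set.subsingleton_of_subsingleton.continuousOn _
  intro P hP
  have hF : ∀ Q, IsRandomSubstitution θ Q → IsWordFrequency θ Q (wordFreq θ (μ Q)) :=
    fun Q hQ => (hμ Q hQ).isWordFrequency
  obtain ⟨C, hC⟩ : ∃ C : ℕ, ∀ a, ∀ w ∈ θ a, w.length ≤ C :=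
    ⟨Finset.univ.sup (maxLen θ), fun a w hw =>
      (Finset.le_sup (f := List.length) hw).trans
        (Finset.le_sup (f := maxLen θ) (Finset.mem_univ a))⟩
  have hmean : ∀ k, meanLen θ P (wordFreq θ (μ P)) k ≠ 0 := fun k =>
    (zero_lt_one.trans_le ((hF P hP).one_le_meanLen hP k)).ne'
  refine continuousWithinAt_of_approx hP (fun k => ?_) (fun k => ?_)
    (fun k Q hQ => abs_measEntropy_sub_le hQ (hμ Q hQ) (hexp Q hQ) hC k)
    ((hF P hP).tendsto_div_meanLen hP (hexp P hP) _)
  · refine ContinuousWithinAt.div ?_ (continuousWithinAt_meanLen hexp hF hP k) (hmean k)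
    exact tendsto_finsetSum _ fun b _ =>
      (continuousWithinAt_pi.1 (continuousWithinAt_letterFrequency hexp hF hP) b).mul
        (continuous_Hvec k b).continuousWithinAt
  · exact continuousWithinAt_const.div (continuousWithinAt_meanLen hexp hF hP k) (hmean k)

end RandomSubstitutionTheory
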